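/- arXiv:2111.04596 — 6 statements merged into one kernel-verified Lean document; each statement's English description precedes it below -/
import Mathlib

section
/- Let J : ℝ^P → ℝ be twice continuously differentiable, lower bounded, and have isolated critical points, and let α ≥ 0, β > 0. Then the set of initial conditions (θ₀, ψ₀) ∈ ℝ^P × ℝ^P such that the solution (θ, ψ) of the DIN system with (θ(0), ψ(0)) = (θ₀, ψ₀) converges as t → ∞ to a point of S_{<0} has Lebesgue measure zero in ℝ^P × ℝ^P. -/
open Filter MeasureTheory Topology

/-- `(θ, ψ)` is a solution of the DIN system
`θ' = −(α − 1/β)θ − (1/β)ψ − β∇J(θ)`, `ψ' = −(α − 1/β)θ − (1/β)ψ`,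
continuously differentiable on `[0, ∞)` (continuity on `[0, ∞)` and the differential
equations for `t > 0`). -/
def IsDINSolution {P : ℕ} (J : EuclideanSpace ℝ (Fin P) → ℝ) (α β : ℝ)
    (θ ψ : ℝ → EuclideanSpace ℝ (Fin P)) : Prop :=
  ContinuousOn θ (Set.Ici 0) ∧ ContinuousOn ψ (Set.Ici 0) ∧
  (∀ t > (0 : ℝ),
    HasDerivAt θ (-(α - 1 / β) • θ t - (1 / β) • ψ t - β • gradient J (θ t)) t) ∧
  (∀ t > (0 : ℝ), HasDerivAt ψ (-(α - 1 / β) • θ t - (1 / β) • ψ t) t)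

/-- `(θ⋆, ψ⋆) ∈ S_{<0}`: a stationary point of DIN whose `θ`-component is a strict
saddle of `J`, i.e. the Hessian of `J` at `θ⋆` has a negative eigenvalue. -/
def IsStrictSaddleStationaryPoint {P : ℕ} (J : EuclideanSpace ℝ (Fin P) → ℝ)
    (α β : ℝ) (q : EuclideanSpace ℝ (Fin P) × EuclideanSpace ℝ (Fin P)) : Prop :=
  gradient J q.1 = 0 ∧ q.2 = (1 - α * β) • q.1 ∧
    ∃ (lam : ℝ) (v : EuclideanSpace ℝ (Fin P)),
      v ≠ 0 ∧ lam < 0 ∧ fderiv ℝ (gradient J) q.1 v = lam • v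

/-- `x` is continuous on `[0, ∞)` and solves the autonomous equation `x' = F x` for `t > 0`. -/
def IsForwardSolution {E : Type*} [NormedAddCommGroup E] [NormedSpace ℝ E]
    (F : E → E) (x : ℝ → E) : Prop :=
  ContinuousOn x (Set.Ici 0) ∧ ∀ t > (0 : ℝ), HasDerivAt x (F (x t)) t

section StableSet

variable {E : Type*} [NormedAddCommGroup E] [NormedSpace ℝ E]

lemma IsForwardSolution.comp_add_const {F : E → E} {x : ℝ → E} (hx : IsForwardSolution F x)
    {T : ℝ} (hT : 0 ≤ T) : IsForwardSolution F (fun t => x (t + T)) := by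
  refine ⟨hx.1.comp (by fun_prop) fun t ht => add_nonneg ht hT, fun t ht => ?_⟩
  exact (hx.2 (t + T) (by linarith)).comp_add_const t T

/-- Backward Gronwall estimate: initial points depend on final points in a Lipschitz way. -/
lemma IsForwardSolution.dist_zero_le {F : E → E} {x y : ℝ → E} {s : Set E} {K : NNReal} {T : ℝ}
    (hF : LipschitzOnWith K F s) (hx : IsForwardSolution F x) (hy : IsForwardSolution F y)
    (hT : 0 ≤ T) (hxs : ∀ t ∈ Set.Icc 0 T, x t ∈ s) (hys : ∀ t ∈ Set.Icc 0 T, y t ∈ s) :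
    dist (x 0) (y 0) ≤ dist (x T) (y T) * Real.exp (K * T) := by
  have hcont : ∀ {z : ℝ → E}, IsForwardSolution F z →
      ContinuousOn (fun t => z (T - t)) (Set.Icc 0 T) := fun hz =>
    hz.1.comp (by fun_prop) fun t ht => sub_nonneg.2 ht.2
  have hderiv : ∀ {z : ℝ → E}, IsForwardSolution F z → ∀ t ∈ Set.Ico 0 T,
      HasDerivWithinAt (fun t => z (T - t)) (-F (z (T - t))) (Set.Ici t) t := fun hz t ht =>
    (HasDerivAt.comp_const_sub T t (hz.2 (T - t) (sub_pos.2 ht.2))).hasDerivWithinAt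
  have hmem : ∀ t ∈ Set.Ico 0 T, T - t ∈ Set.Icc 0 T := fun t ht =>
    ⟨by linarith [ht.2], by linarith [ht.1]⟩
  have h := dist_le_of_trajectories_ODE_of_mem (v := fun _ z => -F z) (s := fun _ => s) (K := K)
    (fun t _ => hF.neg) (hcont hx) (hderiv hx) (fun t ht => hxs _ (hmem t ht))
    (hcont hy) (hderiv hy) (fun t ht => hys _ (hmem t ht)) le_rfl T ⟨hT, le_rfl⟩
  simpa using h

variable [FiniteDimensional ℝ E]

lemma exists_bilinear_posDef :
    ∃ (B : E →L[ℝ] E →L[ℝ] ℝ) (c : ℝ), 0 < c ∧ ∀ z, c * ‖z‖ ^ 2 ≤ B z z := by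
  let e := toEuclidean (E := E)
  let N : ℝ := ‖(e.symm : EuclideanSpace ℝ (Fin (Module.finrank ℝ E)) →L[ℝ] E)‖ + 1
  have hN : 0 < N := by positivity
  refine ⟨(innerSL ℝ).bilinearComp e.toContinuousLinearMap e.toContinuousLinearMap, (N ^ 2)⁻¹,
    by positivity, fun z => ?_⟩
  have h1 : ‖z‖ ≤ N * ‖e z‖ := by
    have := (e.symm : EuclideanSpace ℝ (Fin (Module.finrank ℝ E)) →L[ℝ] E).le_opNorm (e z)
    simp only [ContinuousLinearEquiv.coe_coe, ContinuousLinearEquiv.symm_apply_apply] at this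
    exact this.trans (by gcongr; simp [N])
  have h2 : ‖z‖ ^ 2 ≤ N ^ 2 * ‖e z‖ ^ 2 := by
    rw [← mul_pow]; gcongr
  have h3 : (N ^ 2)⁻¹ * ‖z‖ ^ 2 ≤ ‖e z‖ ^ 2 := by
    rw [inv_mul_le_iff₀ (by positivity)]; exact h2
  simpa [real_inner_self_eq_norm_sq] using h3

lemma exists_surjective_sub_smul {V : Type*} [AddCommGroup V] [Module ℝ V]
    [FiniteDimensional ℝ V] (L : V →ₗ[ℝ] V) {a b : ℝ} (hab : a < b) :
    ∃ ν ∈ Set.Ioo a b, Function.Surjective fun v => L v - ν • v := by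
  obtain ⟨ν, hν, hνL⟩ := ((Set.Ioo_infinite hab).sdiff
    (Module.End.finite_hasEigenvalue L)).nonempty
  refine ⟨ν, hν, (LinearMap.injective_iff_surjective (f := L - ν • LinearMap.id)).1 ?_⟩
  rw [← LinearMap.ker_eq_bot, LinearMap.ker_eq_bot']
  intro v hv
  by_contra hne
  refine hνL (Module.End.hasEigenvalue_of_hasEigenvector (x := v) ⟨?_, hne⟩)
  rw [Module.End.mem_eigenspace_iff]
  exact sub_eq_zero.1 hv

/-- If `A` has a positive eigenvalue, the Lyapunov equation `B(Az, z) + B(z, Az) = ν B(z, z) + B₀`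
is solvable for some `ν > 0` and positive definite `B₀`, by a form positive on the eigenvector. -/
lemma exists_lyapunov_form (A : E →L[ℝ] E) {s : ℝ} (hs : 0 < s) {w : E} (hw : w ≠ 0)
    (hA : A w = s • w) :
    ∃ (B : E →L[ℝ] E →L[ℝ] ℝ) (ν c : ℝ), 0 < ν ∧ 0 < c ∧
      (∀ z, ν * B z z + c * ‖z‖ ^ 2 ≤ B (A z) z + B z (A z)) ∧ 0 < B w w := by
  obtain ⟨B₀, c, hc, hB₀⟩ := exists_bilinear_posDef (E := E)
  let L : (E →L[ℝ] E →L[ℝ] ℝ) →ₗ[ℝ] E →L[ℝ] E →L[ℝ] ℝ :=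
    { toFun := fun B => B.bilinearComp A (.id ℝ E) + B.bilinearComp (.id ℝ E) A
      map_add' := fun B C => by ext; simp; ring
      map_smul' := fun r B => by ext; simp }
  obtain ⟨ν, hν, hsurj⟩ := exists_surjective_sub_smul (V := E →L[ℝ] E →L[ℝ] ℝ) L
    (show (0 : ℝ) < 2 * s by linarith)
  obtain ⟨B, hB⟩ := hsurj B₀
  have hBz : ∀ z, B (A z) z + B z (A z) = ν * B z z + B₀ z z := fun z => by
    have := DFunLike.congr_fun (DFunLike.congr_fun hB z) z
    simp [L] at this
    linarith
  refine ⟨B, ν, c, hν.1, hc, fun z => by rw [hBz]; linarith [hB₀ z], ?_⟩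
  have h1 := hBz w
  simp only [hA, map_smul, smul_apply, smul_eq_mul] at h1
  have h2 : 0 < B₀ w w := lt_of_lt_of_le (by positivity) (hB₀ w)
  by_contra! h3
  nlinarith [hν.2]

/-- Near a point whose linearization has a positive eigenvalue, the differences of solutions
remaining there for all times are negative for a quadratic form that is not negative. -/
lemma exists_nhds_forall_form_nonpos {F : E → E} {q : E} (hF : ContDiff ℝ 1 F) {s : ℝ}
    (hs : 0 < s) {w : E} (hw : w ≠ 0) (hFw : fderiv ℝ F q w = s • w) :
    ∃ U ∈ 𝓝 q, ∃ B : E →L[ℝ] E →L[ℝ] ℝ, 0 < B w w ∧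
      ∀ x y : ℝ → E, IsForwardSolution F x → IsForwardSolution F y →
        (∀ t ≥ (0 : ℝ), x t ∈ U) → (∀ t ≥ (0 : ℝ), y t ∈ U) →
        B (x 0 - y 0) (x 0 - y 0) ≤ 0 := by
  obtain ⟨B, ν, c, hν, hc, hB, hBw⟩ := exists_lyapunov_form _ hs hw hFw
  set A := fderiv ℝ F q
  let η : NNReal := ⟨c / (2 * (‖B‖ + 1)), by positivity⟩
  have hη : 2 * ‖B‖ * η ≤ c := by
    have : (η : ℝ) * (2 * (‖B‖ + 1)) = c := div_mul_cancel₀ _ (by positivity)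
    nlinarith [η.2, norm_nonneg B]
  obtain ⟨V, hV, hVF⟩ := (hF.contDiffAt.hasStrictFDerivAt one_ne_zero
    (x := q)).approximates_deriv_on_nhds (c := η)
      (Or.inr (show (0 : ℝ) < c / (2 * (‖B‖ + 1)) by positivity))
  refine ⟨V ∩ Metric.ball q 1, Filter.inter_mem hV (Metric.ball_mem_nhds q one_pos), B, hBw,
    fun x y hx hy hxU hyU => ?_⟩
  set z : ℝ → E := fun t => x t - y t with hz
  have hzcont : ContinuousOn z (Set.Ici 0) := hx.1.sub hy.1
  have hzbdd : ∀ t ≥ (0 : ℝ), ‖z t‖ ≤ 2 := fun t ht => by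
    have h1 := Metric.mem_ball.1 (hxU t ht).2
    have h2 := Metric.mem_ball.1 (hyU t ht).2
    rw [hz, ← dist_eq_norm]
    linarith [dist_triangle_right (x t) (y t) q]
  have hzderiv : ∀ t > (0 : ℝ), HasDerivAt z (F (x t) - F (y t)) t := fun t ht =>
    (hx.2 t ht).sub (hy.2 t ht)
  have hgrow : ∀ t > (0 : ℝ), ν * B (z t) (z t) ≤
      B (F (x t) - F (y t)) (z t) + B (z t) (F (x t) - F (y t)) := fun t ht => by
    set r := F (x t) - F (y t) - A (z t) with hr
    have hrn : ‖r‖ ≤ η * ‖z t‖ := hVF _ (hxU t ht.le).1 _ (hyU t ht.le).1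
    have hF' : F (x t) - F (y t) = A (z t) + r := by rw [hr]; abel
    rw [hF']
    simp only [map_add, add_apply]
    have h1 : |B r (z t)| ≤ ‖B‖ * (η * ‖z t‖) * ‖z t‖ :=
      (B.le_opNorm₂ r (z t)).trans (by gcongr)
    have h2 : |B (z t) r| ≤ ‖B‖ * ‖z t‖ * (η * ‖z t‖) :=
      (B.le_opNorm₂ (z t) r).trans (by gcongr)
    have h3 := mul_le_mul_of_nonneg_right hη (sq_nonneg ‖z t‖)
    have h4 := hB (z t)
    nlinarith [(abs_le.1 h1).1, (abs_le.1 h2).1]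
  let g : ℝ → ℝ := fun t => Real.exp (-(ν * t)) * B (z t) (z t)
  have hgcont : ContinuousOn g (Set.Ici 0) := by
    have hBz : ContinuousOn (fun t => B (z t) (z t)) (Set.Ici 0) :=
      (B.continuous.comp_continuousOn hzcont).clm_apply hzcont
    exact ContinuousOn.mul (by fun_prop) hBz
  have hgderiv : ∀ t > (0 : ℝ), HasDerivAt g
      (Real.exp (-(ν * t)) * (B (F (x t) - F (y t)) (z t) + B (z t) (F (x t) - F (y t))
        - ν * B (z t) (z t))) t := fun t ht => by
    have h1 : HasDerivAt (fun t => Real.exp (-(ν * t))) (Real.exp (-(ν * t)) * (-(ν * 1))) t :=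
      (((hasDerivAt_id t).const_mul ν).neg).exp
    have h2 := (B.hasFDerivAt.comp_hasDerivAt t (hzderiv t ht)).clm_apply (hzderiv t ht)
    refine (h1.mul h2).congr_deriv ?_
    simp only [Function.comp]
    ring
  have hgmono : MonotoneOn g (Set.Ici 0) := by
    refine monotoneOn_of_deriv_nonneg (convex_Ici 0) hgcont ?_ ?_ <;> rw [interior_Ici]
    · exact fun t ht => (hgderiv t ht).differentiableAt.differentiableWithinAt
    · intro t ht
      rw [(hgderiv t ht).deriv]
      exact mul_nonneg (Real.exp_pos _).le (sub_nonneg.2 (hgrow t ht))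
  have hg0 : g 0 = B (z 0) (z 0) := by simp [g]
  have hglim : Tendsto (fun t : ℝ => Real.exp (-(ν * t)) * (‖B‖ * 2 * 2)) atTop (𝓝 0) := by
    simpa using (Real.tendsto_exp_neg_atTop_nhds_zero.comp
      (tendsto_id.const_mul_atTop hν)).mul_const (‖B‖ * 2 * 2)
  change B (z 0) (z 0) ≤ 0
  rw [← hg0]
  refine ge_of_tendsto hglim ((eventually_ge_atTop 0).mono fun t ht => ?_)
  refine (hgmono Set.self_mem_Ici ht ht).trans
    (mul_le_mul_of_nonneg_left ?_ (Real.exp_pos _).le)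
  refine (le_abs_self _).trans ((B.le_opNorm₂ (z t) (z t)).trans ?_)
  have := hzbdd t ht
  gcongr

variable [MeasurableSpace E] [BorelSpace E]

/-- A set whose differences are nonpositive for a quadratic form that is positive somewhere
is negligible. -/
lemma measure_eq_zero_of_form_nonpos (m : Measure E) [m.IsAddHaarMeasure]
    {B : E →L[ℝ] E →L[ℝ] ℝ} {w : E} (hBw : 0 < B w w) {W : Set E}
    (hW : ∀ x ∈ W, ∀ y ∈ W, B (x - y) (x - y) ≤ 0) : m W = 0 := by
  have hcl : ∀ x ∈ closure W, ∀ y ∈ closure W, B (x - y) (x - y) ≤ 0 := by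
    have hclosed : IsClosed {p : E × E | B (p.1 - p.2) (p.1 - p.2) ≤ 0} :=
      isClosed_le (by fun_prop) continuous_const
    have hsub : closure (W ×ˢ W) ⊆ {p : E × E | B (p.1 - p.2) (p.1 - p.2) ≤ 0} :=
      closure_minimal (fun p hp => hW _ hp.1 _ hp.2) hclosed
    intro x hx y hy
    have hxy : (x, y) ∈ closure (W ×ˢ W) := by rw [closure_prod_eq]; exact ⟨hx, hy⟩
    exact hsub hxy
  refine measure_mono_null subset_closure ?_
  have h := ae_mem_of_ae_add_linearMap_mem (LinearMap.toSpanSingleton ℝ E w) volume m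
    (s := (closure W)ᶜ) isClosed_closure.measurableSet.compl fun y => ?_
  · simpa using measure_eq_zero_iff_ae_notMem.2 h
  have hsub : {t : ℝ | y + t • w ∈ closure W}.Subsingleton := by
    intro t ht r hr
    have h := hcl _ ht _ hr
    rw [show y + t • w - (y + r • w) = (t - r) • w by module] at h
    simp only [map_smul, smul_apply, smul_eq_mul] at h
    by_contra hne
    have : 0 < (t - r) * (t - r) := mul_self_pos.2 (sub_ne_zero.2 hne)
    nlinarith [mul_pos this hBw]
  simpa [ae_iff] using hsub.measure_zero volume

/-- Initial points of solutions staying in a ball up to time `T` and ending in a negligible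
set at time `T` form a negligible set. -/
lemma measure_eq_zero_of_time_shift (m : Measure E) [m.IsAddHaarMeasure] {F : E → E}
    (hF : ContDiff ℝ 1 F) {W : Set E} (hW : m W = 0) {T : ℝ} (hT : 0 ≤ T) (R : ℝ) :
    m {p | ∃ x : ℝ → E, x 0 = p ∧ IsForwardSolution F x ∧
      (∀ t ∈ Set.Icc 0 T, x t ∈ Metric.closedBall 0 R) ∧ x T ∈ W} = 0 := by
  obtain ⟨K, hK⟩ := hF.contDiffOn.exists_lipschitzOnWith (s := Metric.closedBall (0 : E) R)
    one_ne_zero (convex_closedBall 0 R) (isCompact_closedBall 0 R)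
  set S := {p | ∃ x : ℝ → E, x 0 = p ∧ IsForwardSolution F x ∧
      (∀ t ∈ Set.Icc 0 T, x t ∈ Metric.closedBall 0 R) ∧ x T ∈ W}
  choose! X hX0 hX hXR hXW using fun p (hp : p ∈ S) => hp
  have hanti : AntilipschitzWith ⟨Real.exp (K * T), (Real.exp_pos _).le⟩
      (fun p : S => X p T) := by
    refine AntilipschitzWith.of_le_mul_dist fun p r => ?_
    have h := IsForwardSolution.dist_zero_le hK (hX p p.2) (hX r r.2) hT (hXR p p.2) (hXR r r.2)
    rw [hX0 p p.2, hX0 r r.2, mul_comm] at h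
    exact h
  have hd : (0 : ℝ) ≤ Module.finrank ℝ E := Nat.cast_nonneg _
  have hHW : μH[Module.finrank ℝ E] W = 0 :=
    Measure.absolutelyContinuous_isAddHaarMeasure _ m hW
  have h1 := hanti.le_hausdorffMeasure_image hd Set.univ
  have h2 : μH[Module.finrank ℝ E] ((fun p : S => X p T) '' Set.univ) = 0 :=
    measure_mono_null (by rintro _ ⟨p, -, rfl⟩; exact hXW p p.2) hHW
  rw [h2, mul_zero] at h1
  have h3 := (isometry_subtype_coe (s := S)).hausdorffMeasure_image (Or.inl hd) Set.univ
  rw [nonpos_iff_eq_zero.1 h1, Set.image_univ, Subtype.range_coe] at h3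
  exact Measure.absolutelyContinuous_isAddHaarMeasure m _ h3

/-- For a `C¹` vector field, almost no solution converges to a point where the linearization
has a positive eigenvalue. -/
theorem measure_tendsto_unstable_eq_zero (m : Measure E) [m.IsAddHaarMeasure] {F : E → E}
    (hF : ContDiff ℝ 1 F) {S : Set E}
    (hS : ∀ q ∈ S, ∃ (s : ℝ) (w : E), 0 < s ∧ w ≠ 0 ∧ fderiv ℝ F q w = s • w) :
    m {p | ∃ x : ℝ → E, x 0 = p ∧ IsForwardSolution F x ∧
      ∃ q ∈ S, Tendsto x atTop (𝓝 q)} = 0 := by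
  have hloc : ∀ q ∈ S, ∃ U ∈ 𝓝 q, m {p | ∃ x : ℝ → E, x 0 = p ∧ IsForwardSolution F x ∧
      ∀ t ≥ (0 : ℝ), x t ∈ U} = 0 := fun q hq => by
    obtain ⟨s, w, hs, hw, hFw⟩ := hS q hq
    obtain ⟨U, hU, B, hBw, hB⟩ := exists_nhds_forall_form_nonpos hF hs hw hFw
    refine ⟨U, hU, measure_eq_zero_of_form_nonpos m hBw ?_⟩
    rintro _ ⟨x, rfl, hx, hxU⟩ _ ⟨y, rfl, hy, hyU⟩
    exact hB x y hx hy hxU hyU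
  choose! U hU hmU using hloc
  obtain ⟨C, hCS, hC, hSC⟩ := TopologicalSpace.countable_cover_nhdsWithin
    (f := fun q => interior (U q)) (s := S)
    fun q hq => mem_nhdsWithin_of_mem_nhds (interior_mem_nhds.2 (hU q hq))
  have hnull : ∀ q ∈ C, m (⋃ n : ℕ, ⋃ R : ℕ, {p | ∃ x : ℝ → E, x 0 = p ∧
      IsForwardSolution F x ∧ (∀ t ∈ Set.Icc (0 : ℝ) n, x t ∈ Metric.closedBall 0 (R : ℝ)) ∧
      x n ∈ {p | ∃ x : ℝ → E, x 0 = p ∧ IsForwardSolution F x ∧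
        ∀ t ≥ (0 : ℝ), x t ∈ U q}}) = 0 := fun q hq =>
    measure_iUnion_null fun n => measure_iUnion_null fun R =>
      measure_eq_zero_of_time_shift m hF (hmU q (hCS hq)) n.cast_nonneg R
  refine measure_mono_null ?_ ((measure_biUnion_null_iff hC).2 hnull)
  rintro p ⟨x, hx0, hx, q, hq, hlim⟩
  obtain ⟨r, hr, hqr⟩ := Set.mem_iUnion₂.1 (hSC hq)
  obtain ⟨T, hT⟩ := eventually_atTop.1
    (hlim.eventually_mem (isOpen_interior.mem_nhds hqr))
  obtain ⟨n, hn⟩ := exists_nat_ge T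
  obtain ⟨M, hM⟩ := (isCompact_Icc.image_of_continuousOn
    (hx.1.mono (Set.Icc_subset_Ici_self : Set.Icc (0 : ℝ) n ⊆ _))).isBounded.subset_closedBall 0
  obtain ⟨R, hR⟩ := exists_nat_ge M
  simp only [Set.mem_iUnion]
  refine ⟨r, hr, n, R, x, hx0, hx, fun t ht =>
    Metric.closedBall_subset_closedBall hR (hM (Set.mem_image_of_mem x ht)),
    fun t => x (t + n), by simp, hx.comp_add_const n.cast_nonneg, fun t ht => ?_⟩
  exact interior_subset (hT _ (by linarith))

end StableSet

/-- The DIN vector field on the phase space. -/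
noncomputable def dinField {P : ℕ} (J : EuclideanSpace ℝ (Fin P) → ℝ) (α β : ℝ)
    (p : EuclideanSpace ℝ (Fin P) × EuclideanSpace ℝ (Fin P)) :
    EuclideanSpace ℝ (Fin P) × EuclideanSpace ℝ (Fin P) :=
  (-(α - 1 / β) • p.1 - (1 / β) • p.2 - β • gradient J p.1,
    -(α - 1 / β) • p.1 - (1 / β) • p.2)

lemma contDiff_gradient {P : ℕ} {J : EuclideanSpace ℝ (Fin P) → ℝ} (hJ : ContDiff ℝ 2 J) :
    ContDiff ℝ 1 (gradient J) :=
  (InnerProductSpace.toDual ℝ (EuclideanSpace ℝ (Fin P))).symm.contDiff.comp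
    (hJ.fderiv_right (by norm_num))

lemma contDiff_dinField {P : ℕ} {J : EuclideanSpace ℝ (Fin P) → ℝ} (hJ : ContDiff ℝ 2 J)
    (α β : ℝ) : ContDiff ℝ 1 (dinField J α β) := by
  have := contDiff_gradient hJ
  unfold dinField
  fun_prop

lemma fderiv_dinField_apply {P : ℕ} {J : EuclideanSpace ℝ (Fin P) → ℝ} (hJ : ContDiff ℝ 2 J)
    (α β : ℝ) (p h : EuclideanSpace ℝ (Fin P) × EuclideanSpace ℝ (Fin P)) :
    fderiv ℝ (dinField J α β) p h =
      (-(α - 1 / β) • h.1 - (1 / β) • h.2 - β • fderiv ℝ (gradient J) p.1 h.1,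
        -(α - 1 / β) • h.1 - (1 / β) • h.2) := by
  have hg : HasFDerivAt (gradient J) (fderiv ℝ (gradient J) p.1) p.1 :=
    ((contDiff_gradient hJ).differentiable one_ne_zero p.1).hasFDerivAt
  have hlin := ((hasFDerivAt_fst (𝕜 := ℝ) (p := p)).const_smul (-(α - 1 / β))).sub
    ((hasFDerivAt_snd (𝕜 := ℝ) (p := p)).const_smul (1 / β))
  have hgrad : HasFDerivAt (fun r => gradient J r.1) _ p := hg.comp p hasFDerivAt_fst
  have h : HasFDerivAt (dinField J α β) _ p := (hlin.sub (hgrad.const_smul β)).prodMk hlin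
  rw [h.fderiv]
  rfl

/-- At a strict saddle the linearized DIN system has a positive eigenvalue. -/
lemma IsStrictSaddleStationaryPoint.exists_pos_eigenvalue {P : ℕ}
    {J : EuclideanSpace ℝ (Fin P) → ℝ} (hJ : ContDiff ℝ 2 J) {α β : ℝ} (hβ : 0 < β)
    {q : EuclideanSpace ℝ (Fin P) × EuclideanSpace ℝ (Fin P)}
    (hq : IsStrictSaddleStationaryPoint J α β q) :
    ∃ (s : ℝ) (w : EuclideanSpace ℝ (Fin P) × EuclideanSpace ℝ (Fin P)),
      0 < s ∧ w ≠ 0 ∧ fderiv ℝ (dinField J α β) q w = s • w := by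
  obtain ⟨-, -, lam, v, hv, hlam, hHv⟩ := hq
  obtain ⟨s, hs, hchar⟩ : ∃ s : ℝ, 0 < s ∧ s ^ 2 + (α + β * lam) * s + lam = 0 := by
    set b := α + β * lam
    have hD : 0 ≤ b ^ 2 - 4 * lam := by nlinarith [sq_nonneg b]
    refine ⟨(-b + √(b ^ 2 - 4 * lam)) / 2, ?_, by nlinarith [Real.sq_sqrt hD]⟩
    have : |b| < √(b ^ 2 - 4 * lam) := Real.lt_sqrt_of_sq_lt (by rw [sq_abs]; linarith)
    linarith [le_abs_self b]
  have hne : 1 + β * s ≠ 0 := by positivity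
  refine ⟨s, (v, ((1 - α * β) / (1 + β * s)) • v), hs, fun h => hv (Prod.ext_iff.1 h).1, ?_⟩
  rw [fderiv_dinField_apply hJ, hHv]
  ext1
  · simp only [Prod.smul_fst, smul_smul, ← sub_smul]
    congr 1
    field_simp
    linear_combination (-β ^ 2) * hchar
  · simp only [Prod.smul_snd, smul_smul, ← sub_smul]
    congr 1
    field_simp
    ring

/-- Theorem 1 of the paper.
Let `J : ℝ^P → ℝ` be twice continuously differentiable, lower bounded, with isolated
critical points, and `α ≥ 0`, `β > 0`.  Then the set of initial conditions `(θ₀, ψ₀)`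
such that the solution of DIN starting at `(θ₀, ψ₀)` converges to a point of `S_{<0}`
has Lebesgue measure zero in `ℝ^P × ℝ^P`. -/
theorem din_avoids_strict_saddles (P : ℕ) (J : EuclideanSpace ℝ (Fin P) → ℝ)
    (hJ : ContDiff ℝ 2 J) (hbdd : BddBelow (Set.range J))
    (hiso : ∀ θs : EuclideanSpace ℝ (Fin P), gradient J θs = 0 →
      ∃ U ∈ 𝓝 θs, ∀ θ ∈ U, gradient J θ = 0 → θ = θs)
    (α β : ℝ) (hα : 0 ≤ α) (hβ : 0 < β) :
    volume {p : EuclideanSpace ℝ (Fin P) × EuclideanSpace ℝ (Fin P) |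
      ∃ θ ψ : ℝ → EuclideanSpace ℝ (Fin P),
        θ 0 = p.1 ∧ ψ 0 = p.2 ∧ IsDINSolution J α β θ ψ ∧
        ∃ q : EuclideanSpace ℝ (Fin P) × EuclideanSpace ℝ (Fin P),
          IsStrictSaddleStationaryPoint J α β q ∧
          Tendsto (fun t => (θ t, ψ t)) atTop (𝓝 q)} = 0 := by
  have : (volume : Measure
      (EuclideanSpace ℝ (Fin P) × EuclideanSpace ℝ (Fin P))).IsAddHaarMeasure :=
    Measure.prod.instIsAddHaarMeasure _ _
  have hae := measure_tendsto_unstable_eq_zero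
    (volume : Measure (EuclideanSpace ℝ (Fin P) × EuclideanSpace ℝ (Fin P)))
    (contDiff_dinField hJ α β) (S := {q | IsStrictSaddleStationaryPoint J α β q})
    fun q hq => hq.exists_pos_eigenvalue hJ hβ
  refine measure_mono_null ?_ hae
  rintro p ⟨θ, ψ, hθ0, hψ0, ⟨hθ, hψ, hθ', hψ'⟩, q, hq, hlim⟩
  exact ⟨fun t => (θ t, ψ t), Prod.ext hθ0 hψ0,
    ⟨hθ.prodMk hψ, fun t ht => (hθ' t ht).prodMk (hψ' t ht)⟩, q, hq, hlim⟩
end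

section
/- Let H ∈ ℝ^{P×P} be a symmetric matrix with eigenvalues λ₁, …, λ_P (listed with multiplicity), and let α ≥ 0, β > 0. Then the 2P × 2P block matrix M = [[−βH − (α − 1/β)I_P, −(1/β)I_P], [−(α − 1/β)I_P, −(1/β)I_P]] has characteristic polynomial equal to ∏_{p=1}^P (X² + (α + βλ_p)X + λ_p); in particular the eigenvalues of M are exactly the roots of the quadratics X² + (α + βλ_p)X + λ_p for p = 1, …, P. -/
open Polynomial

/-- The determinant of a block matrix whose blocks, except the top left one, are scalar. -/
theorem det_fromBlocks_smul_one {n K : Type*} [Fintype n] [DecidableEq n] [Field K]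
    (A : Matrix n n K) (b c : K) {d : K} (hd : d ≠ 0) :
    (Matrix.fromBlocks A (b • (1 : Matrix n n K)) (c • (1 : Matrix n n K))
      (d • (1 : Matrix n n K))).det = (d • A - (b * c) • (1 : Matrix n n K)).det := by
  let _ : Invertible (d • (1 : Matrix n n K)) :=
    ⟨d⁻¹ • 1, by simp [smul_smul, hd], by simp [smul_smul, hd]⟩
  have hinv : ⅟(d • (1 : Matrix n n K)) = d⁻¹ • 1 := rfl
  rw [Matrix.det_fromBlocks₂₂, hinv, ← Matrix.det_mul]
  congr 1
  simp only [smul_mul_assoc, one_mul, mul_smul_comm, mul_one, smul_sub, smul_smul]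
  congr 2
  field_simp

/-- The determinant of an affine expression in a matrix with split characteristic polynomial. -/
theorem det_smul_one_add_smul {n K : Type*} [Fintype n] [DecidableEq n] [Field K]
    {H : Matrix n n K} {lam : n → K} (hlam : H.charpoly = ∏ p, (X - C (lam p))) (u v : K) :
    (u • (1 : Matrix n n K) + v • H).det = ∏ p, (u + v * lam p) := by
  rcases eq_or_ne v 0 with rfl | hv
  · simp
  · have hmat : u • (1 : Matrix n n K) + v • H = (-v) • (Matrix.scalar n (-u / v) - H) := by
      rw [Matrix.scalar_apply, ← Matrix.smul_one_eq_diagonal, smul_sub, smul_smul, neg_smul,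
        sub_neg_eq_add]
      congr 2
      field_simp
    rw [hmat, Matrix.det_smul, ← Matrix.eval_charpoly, hlam, eval_prod, ← Finset.card_univ,
      ← Finset.prod_const, ← Finset.prod_mul_distrib]
    refine Finset.prod_congr rfl fun p _ => ?_
    simp only [eval_sub, eval_X, eval_C]
    field_simp
    ring

/-- Let `H` be a real symmetric `P × P` matrix with eigenvalues `λ₁, …, λ_P` (listed with
multiplicity, encoded by `H.charpoly = ∏ (X − λ_p)`), and let `α ≥ 0`, `β > 0`.  Then the
`2P × 2P` block matrix
`M = [[−βH − (α − 1/β)I, −(1/β)I], [−(α − 1/β)I, −(1/β)I]]`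
has characteristic polynomial `∏_{p=1}^P (X² + (α + βλ_p)X + λ_p)`; in particular the
real eigenvalues of `M` are exactly the real roots of the quadratics
`X² + (α + βλ_p)X + λ_p`. -/
theorem din_jacobian_charpoly (P : ℕ) (H : Matrix (Fin P) (Fin P) ℝ) (hH : H.IsSymm)
    (lam : Fin P → ℝ) (hlam : H.charpoly = ∏ p : Fin P, (X - C (lam p)))
    (α β : ℝ) (hα : 0 ≤ α) (hβ : 0 < β) :
    (Matrix.fromBlocks
        (-(β • H) - (α - 1 / β) • (1 : Matrix (Fin P) (Fin P) ℝ))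
        (-((1 / β) • (1 : Matrix (Fin P) (Fin P) ℝ)))
        (-((α - 1 / β) • (1 : Matrix (Fin P) (Fin P) ℝ)))
        (-((1 / β) • (1 : Matrix (Fin P) (Fin P) ℝ)))).charpoly =
      ∏ p : Fin P, (X ^ 2 + C (α + β * lam p) * X + C (lam p)) ∧
    ∀ x : ℝ,
      (Matrix.fromBlocks
          (-(β • H) - (α - 1 / β) • (1 : Matrix (Fin P) (Fin P) ℝ))
          (-((1 / β) • (1 : Matrix (Fin P) (Fin P) ℝ)))
          (-((α - 1 / β) • (1 : Matrix (Fin P) (Fin P) ℝ)))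
          (-((1 / β) • (1 : Matrix (Fin P) (Fin P) ℝ)))).charpoly.IsRoot x ↔
        ∃ p : Fin P, x ^ 2 + (α + β * lam p) * x + lam p = 0 := by
  have hchar : (Matrix.fromBlocks
        (-(β • H) - (α - 1 / β) • (1 : Matrix (Fin P) (Fin P) ℝ))
        (-((1 / β) • (1 : Matrix (Fin P) (Fin P) ℝ)))
        (-((α - 1 / β) • (1 : Matrix (Fin P) (Fin P) ℝ)))
        (-((1 / β) • (1 : Matrix (Fin P) (Fin P) ℝ)))).charpoly =
      ∏ p : Fin P, (X ^ 2 + C (α + β * lam p) * X + C (lam p)) := by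
    refine eq_of_infinite_eval_eq _ _
      ((Set.finite_singleton (-(1 / β))).infinite_compl.mono fun x hx => ?_)
    have hd : x + 1 / β ≠ 0 := fun h => hx (eq_neg_of_add_eq_zero_left h)
    have hblocks : Matrix.scalar (Fin P ⊕ Fin P) x - Matrix.fromBlocks
        (-(β • H) - (α - 1 / β) • (1 : Matrix (Fin P) (Fin P) ℝ))
        (-((1 / β) • (1 : Matrix (Fin P) (Fin P) ℝ)))
        (-((α - 1 / β) • (1 : Matrix (Fin P) (Fin P) ℝ)))
        (-((1 / β) • (1 : Matrix (Fin P) (Fin P) ℝ))) =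
      Matrix.fromBlocks ((x + (α - 1 / β)) • (1 : Matrix (Fin P) (Fin P) ℝ) + β • H)
        ((1 / β) • (1 : Matrix (Fin P) (Fin P) ℝ))
        ((α - 1 / β) • (1 : Matrix (Fin P) (Fin P) ℝ))
        ((x + 1 / β) • (1 : Matrix (Fin P) (Fin P) ℝ)) := by
      rw [Matrix.scalar_apply, ← Matrix.smul_one_eq_diagonal, ← Matrix.fromBlocks_one,
        Matrix.fromBlocks_smul, sub_eq_add_neg, Matrix.fromBlocks_neg, Matrix.fromBlocks_add]
      congr 1
      · module
      · module
      · module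
      · module
    have hschur : (x + 1 / β) • ((x + (α - 1 / β)) • (1 : Matrix (Fin P) (Fin P) ℝ) + β • H) -
        (1 / β * (α - 1 / β)) • (1 : Matrix (Fin P) (Fin P) ℝ) =
        (x ^ 2 + α * x) • (1 : Matrix (Fin P) (Fin P) ℝ) + (β * x + 1) • H := by
      have hv : β * x + 1 = (x + 1 / β) * β := by field_simp
      rw [hv]
      module
    rw [Set.mem_ofPred_eq, Matrix.eval_charpoly, hblocks, det_fromBlocks_smul_one _ _ _ hd, hschur,
      det_smul_one_add_smul hlam, eval_prod]
    refine Finset.prod_congr rfl fun p _ => ?_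
    simp only [eval_add, eval_mul, eval_pow, eval_X, eval_C]
    ring
  refine ⟨hchar, fun x => ?_⟩
  rw [hchar, IsRoot.def, eval_prod, Finset.prod_eq_zero_iff]
  simp
end

section
/- Let J : ℝ^P → ℝ be twice continuously differentiable, lower bounded, with isolated critical points and with L-Lipschitz continuous gradient for some L > 0. Let α > 0, β > 0, and let the step-size γ satisfy 0 < γ < min(β/2 + α/(2L) − √((α + βL)² − 4L)/(2L), β) (this upper bound is always positive). Then the set of initializations (θ₀, ψ₀) ∈ ℝ^P × ℝ^P such that the INNA iterates (θ_k, ψ_k) converge to a point of S_{<0} has Lebesgue measure zero in ℝ^P × ℝ^P. -/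
open Filter MeasureTheory Topology

/-- One step of the INNA algorithm with parameters `α`, `β` and step-size `γ`:
`θ⁺ = θ + γ[−(α − 1/β)θ − (1/β)ψ − β∇J(θ)]`, `ψ⁺ = ψ + γ[−(α − 1/β)θ − (1/β)ψ]`. -/
noncomputable def innaStep {P : ℕ} (J : EuclideanSpace ℝ (Fin P) → ℝ) (α β γ : ℝ)
    (p : EuclideanSpace ℝ (Fin P) × EuclideanSpace ℝ (Fin P)) :
    EuclideanSpace ℝ (Fin P) × EuclideanSpace ℝ (Fin P) :=
  (p.1 + γ • (-(α - 1 / β) • p.1 - (1 / β) • p.2 - β • gradient J p.1),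
   p.2 + γ • (-(α - 1 / β) • p.1 - (1 / β) • p.2))

section Dynamics

variable {V : Type*} [NormedAddCommGroup V] [NormedSpace ℝ V] [FiniteDimensional ℝ V]

/-- A positive definite difference of quadratic forms is coercive. -/
theorem exists_pos_mul_sq_norm_le_of_quadratic_lt (B : V →L[ℝ] V →L[ℝ] ℝ) (T : V →L[ℝ] V) (a : ℝ)
    (h : ∀ z, z ≠ 0 → a * B z z < B (T z) (T z)) :
    ∃ δ > 0, ∀ z, a * B z z + δ * ‖z‖ ^ 2 ≤ B (T z) (T z) := by
  have : ProperSpace V := FiniteDimensional.proper ℝ V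
  rcases subsingleton_or_nontrivial V with hV | hV
  · exact ⟨1, one_pos, fun z => by simp [Subsingleton.elim z 0]⟩
  · have hcont : Continuous fun z : V => B (T z) (T z) - a * B z z := by fun_prop
    obtain ⟨w, hw, hmin⟩ := (isCompact_sphere (0 : V) 1).exists_isMinOn
      (NormedSpace.sphere_nonempty.2 zero_le_one) hcont.continuousOn
    have hw0 : w ≠ 0 := by rintro rfl; simp at hw
    refine ⟨B (T w) (T w) - a * B w w, sub_pos.2 (h w hw0), fun z => ?_⟩
    rcases eq_or_ne z 0 with rfl | hz
    · simp
    have hz' : ‖z‖ ≠ 0 := norm_ne_zero_iff.2 hz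
    have key := hmin (show ‖z‖⁻¹ • z ∈ Metric.sphere (0 : V) 1 by
      simp [norm_smul, hz'])
    simp only [map_smul, smul_apply, smul_eq_mul, Set.mem_ofPred_eq] at key
    have h2 := mul_le_mul_of_nonneg_right key (sq_nonneg ‖z‖)
    field_simp at h2
    linarith

/-- If a quadratic form increases by a factor `a` under the derivative of `g` at `q`, then the same
holds for differences of values of `g` near `q`. -/
theorem exists_nhds_quadratic_le {g : V → V} {T : V →L[ℝ] V} {q : V}
    (hg : HasStrictFDerivAt g T q) (B : V →L[ℝ] V →L[ℝ] ℝ) (a : ℝ)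
    (h : ∀ z, z ≠ 0 → a * B z z < B (T z) (T z)) :
    ∃ U ∈ 𝓝 q, ∀ x ∈ U, ∀ y ∈ U, a * B (x - y) (x - y) ≤ B (g x - g y) (g x - g y) := by
  obtain ⟨δ, hδ, hB⟩ := exists_pos_mul_sq_norm_le_of_quadratic_lt B T a h
  obtain ⟨ε, hε, hε0⟩ : ∃ ε : ℝ, ‖B‖ * (2 * ‖T‖ * ε + ε ^ 2) < δ ∧ 0 < ε := by
    have hc : Continuous fun ε : ℝ => ‖B‖ * (2 * ‖T‖ * ε + ε ^ 2) := by fun_prop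
    have h1 : ∀ᶠ ε in 𝓝[>] (0 : ℝ), ‖B‖ * (2 * ‖T‖ * ε + ε ^ 2) < δ :=
      nhdsWithin_le_nhds (hc.continuousAt.eventually_lt continuousAt_const (by simpa using hδ))
    exact (h1.and self_mem_nhdsWithin).exists
  lift ε to NNReal using hε0.le
  obtain ⟨U, hU, happ⟩ := hg.approximates_deriv_on_nhds (Or.inr (by exact_mod_cast hε0) :
    Subsingleton V ∨ 0 < ε)
  refine ⟨U, hU, fun x hx y hy => ?_⟩
  have he := happ x hx y hy
  set z := x - y
  obtain ⟨e, hge⟩ : ∃ e, g x - g y = T z + e := ⟨g x - g y - T z, by abel⟩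
  rw [hge, add_sub_cancel_left] at he
  rw [hge]
  have hTz := T.le_opNorm z
  have b1 : |B (T z) e| ≤ ‖B‖ * (‖T‖ * ‖z‖) * (ε * ‖z‖) :=
    (B.le_opNorm₂ _ _).trans (by gcongr)
  have b2 : |B e (T z)| ≤ ‖B‖ * (ε * ‖z‖) * (‖T‖ * ‖z‖) :=
    (B.le_opNorm₂ _ _).trans (by gcongr)
  have b3 : |B e e| ≤ ‖B‖ * (ε * ‖z‖) * (ε * ‖z‖) :=
    (B.le_opNorm₂ _ _).trans (by gcongr)
  have h4 := mul_le_mul_of_nonneg_right hε.le (sq_nonneg ‖z‖)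
  have h5 := hB z
  simp only [map_add, add_apply]
  have := neg_le_of_abs_le b1
  have := neg_le_of_abs_le b2
  have := neg_le_of_abs_le b3
  linarith

variable [MeasurableSpace V] [BorelSpace V]

/-- A closed set meeting every line of a given direction in at most one point is null. -/
theorem addHaar_eq_zero_of_subsingleton_line (μ : Measure V) [μ.IsAddHaarMeasure] {W : Set V}
    (hW : IsClosed W) (v : V) (h : ∀ x : V, {c : ℝ | x + c • v ∈ W}.Subsingleton) : μ W = 0 := by
  have : ProperSpace V := FiniteDimensional.proper ℝ V
  have key := ae_mem_of_ae_add_linearMap_mem (LinearMap.toSpanSingleton ℝ V v)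
    (volume : Measure ℝ) μ hW.measurableSet.compl (fun x => by
      have := (h x).measure_zero (volume : Measure ℝ)
      simpa [ae_iff] using this)
  simpa [ae_iff] using key

/-- Local avoidance: if some quadratic form, positive somewhere, is expanded by the derivative of `g`
at `q` by a factor `a > 1`, then the points whose orbit stays near `q` form a null set. -/
theorem exists_nhds_addHaar_stay_eq_zero (μ : Measure V) [μ.IsAddHaarMeasure] {g : V → V}
    (hgc : Continuous g) {T : V →L[ℝ] V} {q : V} (hg : HasStrictFDerivAt g T q)
    (B : V →L[ℝ] V →L[ℝ] ℝ) {a : ℝ} (ha : 1 < a)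
    (h : ∀ z, z ≠ 0 → a * B z z < B (T z) (T z)) {v : V} (hv : 0 < B v v) :
    ∃ U ∈ 𝓝 q, μ {x | ∀ k, g^[k] x ∈ U} = 0 := by
  obtain ⟨U, hU, hexp⟩ := exists_nhds_quadratic_le hg B a h
  obtain ⟨r, hr, hrU⟩ := Metric.nhds_basis_closedBall.mem_iff.1 hU
  refine ⟨Metric.closedBall q r, Metric.closedBall_mem_nhds q hr, ?_⟩
  refine addHaar_eq_zero_of_subsingleton_line μ ?_ v ?_
  · simp only [Set.ofPred_forall]
    exact isClosed_iInter fun k => Metric.isClosed_closedBall.preimage (hgc.iterate k)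
  intro x c hc c' hc'
  by_contra hne
  set y := x + c • v
  set y' := x + c' • v
  have hpos : 0 < B (y - y') (y - y') := by
    have : y - y' = (c - c') • v := by simp only [y, y']; module
    rw [this]
    simp only [map_smul, smul_apply, smul_eq_mul]
    have := mul_self_pos.2 (sub_ne_zero.2 hne)
    nlinarith [mul_pos this hv]
  have hgrow : ∀ k, a ^ k * B (y - y') (y - y') ≤
      B (g^[k] y - g^[k] y') (g^[k] y - g^[k] y') := by
    intro k
    induction k with
    | zero => simp
    | succ k ih =>
      rw [Function.iterate_succ_apply', Function.iterate_succ_apply', pow_succ']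
      refine le_trans ?_ (hexp _ (hrU (hc k)) _ (hrU (hc' k)))
      rw [mul_assoc]
      gcongr
  have hbdd : ∀ k, B (g^[k] y - g^[k] y') (g^[k] y - g^[k] y') ≤ ‖B‖ * (r + r) * (r + r) := by
    intro k
    have hd : ‖g^[k] y - g^[k] y'‖ ≤ r + r := by
      rw [← dist_eq_norm]
      exact (dist_triangle_right _ _ q).trans (add_le_add (hc k) (hc' k))
    exact (le_abs_self _).trans ((B.le_opNorm₂ _ _).trans (by gcongr))
  obtain ⟨k, hk⟩ := pow_unbounded_of_one_lt (‖B‖ * (r + r) * (r + r) / B (y - y') (y - y')) ha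
  rw [div_lt_iff₀ hpos] at hk
  exact absurd ((hgrow k).trans (hbdd k)) (not_le.2 hk)

/-- Preimages of null sets under a `C¹` map with everywhere injective derivative are null. -/
theorem addHaar_preimage_eq_zero_of_injective_fderiv (μ : Measure V) [μ.IsAddHaarMeasure]
    {g : V → V} (hg : ContDiff ℝ 1 g) (hinj : ∀ x, Function.Injective (fderiv ℝ g x))
    {s : Set V} (hs : μ s = 0) : μ (g ⁻¹' s) = 0 := by
  refine measure_null_of_locally_null _ fun x _ => ?_
  let e : V ≃L[ℝ] V := (LinearEquiv.ofInjectiveEndo (fderiv ℝ g x : V →ₗ[ℝ] V)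
    (hinj x)).toContinuousLinearEquiv
  have hx : HasFDerivAt g (e : V →L[ℝ] V) x := by
    have : (e : V →L[ℝ] V) = fderiv ℝ g x := by ext; rfl
    rw [this]
    exact (hg.differentiable one_ne_zero x).hasFDerivAt
  have hstrict := hg.contDiffAt.hasStrictFDerivAt' hx one_ne_zero
  set f := (hg.contDiffAt (x := x)).localInverse hx one_ne_zero
  have hf : ContDiffAt ℝ 1 f (g x) := hg.contDiffAt.to_localInverse hx one_ne_zero
  have hu : ∀ᶠ y in 𝓝 (g x), ContDiffAt ℝ 1 f y := hf.eventually (by simp)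
  have hleft : ∀ᶠ y in 𝓝 x, f (g y) = y := hstrict.eventually_left_inverse
  refine ⟨g ⁻¹' s ∩ {y | f (g y) = y ∧ ContDiffAt ℝ 1 f (g y)}, inter_mem_nhdsWithin _
    (hleft.and (hg.continuous.continuousAt.eventually hu)), ?_⟩
  have himg : μ (f '' (s ∩ {y | ContDiffAt ℝ 1 f y})) = 0 :=
    addHaar_image_eq_zero_of_differentiableOn_of_addHaar_eq_zero μ
      (fun y hy => ((show ContDiffAt ℝ 1 f y from hy.2).differentiableAt
        one_ne_zero).differentiableWithinAt)
      (measure_mono_null Set.inter_subset_left hs)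
  refine measure_mono_null ?_ himg
  rintro y ⟨hys, hfy, hcy⟩
  exact ⟨g y, ⟨hys, hcy⟩, hfy⟩

/-- Global avoidance: if every point of `S` has a neighbourhood in which only a null set of orbits
stays forever, then almost no orbit of `g` converges to a point of `S`. -/
theorem addHaar_tendsto_iterate_eq_zero (μ : Measure V) [μ.IsAddHaarMeasure]
    {g : V → V} (hg : ContDiff ℝ 1 g) (hinj : ∀ x, Function.Injective (fderiv ℝ g x)) {S : Set V}
    (hS : ∀ q ∈ S, ∃ U ∈ 𝓝 q, μ {x | ∀ k, g^[k] x ∈ U} = 0) :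
    μ {x | ∃ q ∈ S, Tendsto (fun k => g^[k] x) atTop (𝓝 q)} = 0 := by
  choose! U hU hμ using hS
  obtain ⟨t, htS, htc, hcover⟩ := TopologicalSpace.countable_cover_nhdsWithin
    (s := S) (f := fun q => interior (U q))
    fun q hq => mem_nhdsWithin_of_mem_nhds (interior_mem_nhds.2 (hU q hq))
  have hnull : μ (⋃ q ∈ t, ⋃ m : ℕ, g^[m] ⁻¹' {x | ∀ k, g^[k] x ∈ U q}) = 0 := by
    refine (measure_biUnion_null_iff htc).2 fun q hq => measure_iUnion_null fun m => ?_
    induction m with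
    | zero => exact hμ q (htS hq)
    | succ m ih =>
      rw [Function.iterate_succ, Set.preimage_comp]
      exact addHaar_preimage_eq_zero_of_injective_fderiv μ hg hinj ih
  refine measure_mono_null ?_ hnull
  rintro x ⟨q, hqS, hx⟩
  obtain ⟨p, hp, hqp⟩ := Set.mem_iUnion₂.1 (hcover hqS)
  obtain ⟨m, hm⟩ := eventually_atTop.1 (hx (isOpen_interior.mem_nhds hqp))
  refine Set.mem_iUnion₂.2 ⟨p, hp, Set.mem_iUnion.2 ⟨m, fun k => ?_⟩⟩
  rw [← Function.iterate_add_apply]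
  exact interior_subset (hm (k + m) (Nat.le_add_left m k))

end Dynamics

section SchurCohn

variable {E : Type*} [NormedAddCommGroup E] [InnerProductSpace ℝ E]

/-- The Schur–Cohn form of the recurrence `x (k + 2) = t (x (k + 1)) - D (x k)` increases along
its solutions. -/
theorem schurCohn_identity {D t : E →L[ℝ] E} (hD : ∀ x y, inner ℝ (D x) y = inner ℝ x (D y))
    (ht : ∀ x y, inner ℝ (t x) y = inner ℝ x (t y)) (hDt : ∀ x, D (t x) = t (D x)) (a b c : E)
    (hc : c = t b - D a) :
    2 * inner ℝ (b - D b) (t c) - inner ℝ (b - D b) (b + D b) - inner ℝ (c - D c) (c + D c) =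
      2 * inner ℝ (a - D a) (t b) - inner ℝ (a - D a) (a + D a) - inner ℝ (b - D b) (b + D b) +
        ‖(a - D a) - (c - D c)‖ ^ 2 := by
  have htb : t b = c + D a := by rw [hc]; abel
  have h1 : inner ℝ (b - D b) (t c) = inner ℝ (c + D a) (c - D c) := by
    rw [← ht, map_sub, ← hDt, htb]
    simp only [inner_sub_left, inner_sub_right, hD]
  rw [h1, htb, ← real_inner_self_eq_norm_sq]
  simp only [inner_sub_left, inner_sub_right, inner_add_left, inner_add_right]
  have e1 := real_inner_comm (D a) a
  have e2 := real_inner_comm (D c) c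
  have e3 := real_inner_comm (D a) c
  have e4 := real_inner_comm (D c) a
  have e5 := real_inner_comm (D a) (D c)
  have e6 := hD a c
  have e7 := real_inner_comm a c
  linarith

variable {V : Type*} [NormedAddCommGroup V] [NormedSpace ℝ V]

/-- The Schur–Cohn form of the recurrence `x (k + 2) = t (x (k + 1)) - D (x k)`, in the coordinates
`X z`, `Y z` for `x 0`, `x 1`. -/
noncomputable def schurCohnForm (D t : E →L[ℝ] E) (X Y : V →L[ℝ] E) : V →L[ℝ] V →L[ℝ] ℝ :=
  (2 : ℝ) • (innerSL ℝ).bilinearComp (X - D.comp X) (t.comp Y) -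
    (innerSL ℝ).bilinearComp (X - D.comp X) (X + D.comp X) -
    (innerSL ℝ).bilinearComp (Y - D.comp Y) (Y + D.comp Y)

theorem schurCohnForm_apply (D t : E →L[ℝ] E) (X Y : V →L[ℝ] E) (z : V) :
    schurCohnForm D t X Y z z =
      2 * inner ℝ (X z - D (X z)) (t (Y z)) - inner ℝ (X z - D (X z)) (X z + D (X z)) -
        inner ℝ (Y z - D (Y z)) (Y z + D (Y z)) := by
  simp [schurCohnForm, inner_sub_left]

/-- For `T` conjugate to a companion operator and `s > 0`, the Schur–Cohn form of `s⁻¹ • T`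
increases along `s⁻¹ • T`. -/
theorem schurCohnForm_map {D t : E →L[ℝ] E} (hD : ∀ x y, inner ℝ (D x) y = inner ℝ x (D y))
    (ht : ∀ x y, inner ℝ (t x) y = inner ℝ x (t y)) (hDt : ∀ x, D (t x) = t (D x))
    {T : V →L[ℝ] V} {X : V →L[ℝ] E} (hrec : ∀ z, X (T (T z)) = t (X (T z)) - D (X z))
    {s : ℝ} (hs : s ≠ 0) (z : V) :
    schurCohnForm ((s⁻¹ ^ 2) • D) (s⁻¹ • t) X (s⁻¹ • X.comp T) (T z) (T z) =
      s ^ 2 * (schurCohnForm ((s⁻¹ ^ 2) • D) (s⁻¹ • t) X (s⁻¹ • X.comp T) z z +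
        ‖(X z - (s⁻¹ ^ 2) • X (T (T z))) -
          (s⁻¹ ^ 2) • D (X z - (s⁻¹ ^ 2) • X (T (T z)))‖ ^ 2) := by
  have key := schurCohn_identity (D := (s⁻¹ ^ 2) • D) (t := s⁻¹ • t)
    (by simp [inner_smul_left, inner_smul_right, hD])
    (by simp [inner_smul_left, inner_smul_right, ht])
    (by intro x; simp only [smul_apply, map_smul, hDt]; rw [smul_comm])
    (X z) (s⁻¹ • X (T z)) ((s⁻¹ ^ 2) • X (T (T z))) (by
      rw [hrec z]
      simp only [smul_apply, map_smul, smul_sub, smul_smul]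
      ring_nf)
  have hn : (X z - (s⁻¹ ^ 2) • X (T (T z))) - (s⁻¹ ^ 2) • D (X z - (s⁻¹ ^ 2) • X (T (T z))) =
      (X z - ((s⁻¹ ^ 2) • D) (X z)) - ((s⁻¹ ^ 2) • X (T (T z)) -
        ((s⁻¹ ^ 2) • D) ((s⁻¹ ^ 2) • X (T (T z)))) := by
    simp only [map_sub, smul_apply, smul_sub, map_smul]
    abel
  rw [hn, schurCohnForm_apply, schurCohnForm_apply]
  simp only [smul_apply, ContinuousLinearMap.comp_apply] at key ⊢
  rw [← key]
  simp only [map_smul, inner_sub_left, inner_add_right, inner_smul_left, inner_smul_right, conj_trivial]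
  field_simp

variable [FiniteDimensional ℝ E] [FiniteDimensional ℝ V]

/-- A companion operator with a real eigenvalue `> 1`, witnessed by a negative value at `1` of the
characteristic polynomial on a common eigenvector of the coefficients, has an expanding quadratic
form for its square. -/
theorem exists_expanding_form {D t : E →L[ℝ] E} (hD : ∀ x y, inner ℝ (D x) y = inner ℝ x (D y))
    (ht : ∀ x y, inner ℝ (t x) y = inner ℝ x (t y)) (hDt : ∀ x, D (t x) = t (D x))
    {T : V →L[ℝ] V} {X : V →L[ℝ] E} (hrec : ∀ z, X (T (T z)) = t (X (T z)) - D (X z))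
    (hinj : ∀ z, X z = 0 → X (T z) = 0 → z = 0)
    (hsurj : ∀ a b, ∃ z, X z = a ∧ X (T z) = b)
    {v : E} (hv : v ≠ 0) {d τ : ℝ} (hdv : D v = d • v) (htv : t v = τ • v) (hd : 0 < d)
    (hneg : 1 - τ + d < 0) :
    ∃ (B : V →L[ℝ] V →L[ℝ] ℝ) (a : ℝ), 1 < a ∧
      (∀ z, z ≠ 0 → a * B z z < B ((T.comp T) z) ((T.comp T) z)) ∧ ∃ w, 0 < B w w := by
  obtain ⟨s, hs1, hsneg, hsT, hsT', hsD⟩ : ∃ s : ℝ, 1 < s ∧ s ^ 2 - τ * s + d < 0 ∧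
      ¬ Module.End.HasEigenvalue (T : Module.End ℝ V) s ∧
      ¬ Module.End.HasEigenvalue (T : Module.End ℝ V) (-s) ∧
      ¬ Module.End.HasEigenvalue (D : Module.End ℝ E) (s ^ 2) := by
    have hc : ContinuousAt (fun s : ℝ => s ^ 2 - τ * s + d) 1 := by fun_prop
    have hev : ∀ᶠ s in 𝓝[>] (1 : ℝ), s ^ 2 - τ * s + d < 0 :=
      nhdsWithin_le_nhds (hc.eventually_lt continuousAt_const (by linarith))
    obtain ⟨u, hu, hsub⟩ := mem_nhdsGT_iff_exists_Ioo_subset.1 hev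
    have hfT := Module.End.finite_hasEigenvalue (T : Module.End ℝ V)
    have hfD := Module.End.finite_hasEigenvalue (D : Module.End ℝ E)
    obtain ⟨s, hs, hsn⟩ := (Set.Ioo_infinite hu).exists_notMem_finite
      ((hfT.union (hfT.image Neg.neg)).union (hfD.image Real.sqrt))
    simp only [Set.mem_union, Set.mem_image, not_or, not_exists, not_and] at hsn
    exact ⟨s, hs.1, hsub hs, hsn.1.1, fun h => hsn.1.2 _ h (neg_neg s),
      fun h => hsn.2 _ h (Real.sqrt_sq (zero_le_one.trans hs.1.le))⟩
  have hs0 : 0 < s := one_pos.trans hs1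
  have hDinj : ∀ x, x - (s⁻¹ ^ 2) • D x = 0 → x = 0 := by
    intro x hx
    by_contra hx0
    refine hsD (Module.End.hasEigenvalue_of_hasEigenvector (x := x)
      (Module.End.hasEigenvector_iff.2 ⟨Module.End.mem_eigenspace_iff.2 ?_, hx0⟩))
    have h1 : x = (s⁻¹ ^ 2) • D x := sub_eq_zero.1 hx
    have h2 : s ^ 2 • x = D x := by
      nth_rewrite 1 [h1]
      rw [smul_smul, ← mul_pow, mul_inv_cancel₀ hs0.ne', one_pow, one_smul]
    exact h2.symm
  have hTinj : ∀ z, T (T z) = s ^ 2 • z → z = 0 := by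
    intro z hz
    have h1 : T z + s • z = 0 := by
      by_contra h0
      refine hsT (Module.End.hasEigenvalue_of_hasEigenvector (x := T z + s • z)
        (Module.End.hasEigenvector_iff.2 ⟨Module.End.mem_eigenspace_iff.2 ?_, h0⟩))
      change T (T z + s • z) = _
      rw [map_add, map_smul, hz]
      module
    by_contra h0
    refine hsT' (Module.End.hasEigenvalue_of_hasEigenvector (x := z)
        (Module.End.hasEigenvector_iff.2 ⟨Module.End.mem_eigenspace_iff.2 ?_, h0⟩))
    change T z = _
    rw [eq_neg_of_add_eq_zero_left h1, neg_smul]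
  have hmap := schurCohnForm_map hD ht hDt hrec hs0.ne'
  refine ⟨schurCohnForm ((s⁻¹ ^ 2) • D) (s⁻¹ • t) X (s⁻¹ • X.comp T), s ^ 4,
    one_lt_pow₀ hs1 (by norm_num), fun z hz => ?_, ?_⟩
  · set B := schurCohnForm ((s⁻¹ ^ 2) • D) (s⁻¹ • t) X (s⁻¹ • X.comp T)
    rw [ContinuousLinearMap.comp_apply, hmap (T z), hmap z]
    set p := (X z - (s⁻¹ ^ 2) • X (T (T z))) - (s⁻¹ ^ 2) • D (X z - (s⁻¹ ^ 2) • X (T (T z)))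
      with hp
    set r := (X (T z) - (s⁻¹ ^ 2) • X (T (T (T z)))) -
      (s⁻¹ ^ 2) • D (X (T z) - (s⁻¹ ^ 2) • X (T (T (T z)))) with hr
    have hpos : 0 < s ^ 2 * ‖p‖ ^ 2 + ‖r‖ ^ 2 := by
      by_contra hle
      have hp0 : p = 0 := by
        by_contra h0
        have := norm_pos_iff.2 h0
        exact hle (by positivity)
      have hr0 : r = 0 := by
        by_contra h0
        have := norm_pos_iff.2 h0
        exact hle (by positivity)
      have h1 := sub_eq_zero.1 (hDinj _ hp0)
      have h2 := sub_eq_zero.1 (hDinj _ hr0)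
      have hcancel : ∀ x : E, s ^ 2 • (s⁻¹ ^ 2) • x = x := fun x => by
        rw [smul_smul, ← mul_pow, mul_inv_cancel₀ hs0.ne', one_pow, one_smul]
      refine hz (hTinj z (sub_eq_zero.1 (hinj _ ?_ ?_)))
      · rw [map_sub, map_smul, h1, hcancel, sub_self]
      · rw [map_sub, map_sub, map_smul, map_smul, h2, hcancel, sub_self]
    have := mul_pos (pow_pos hs0 2) hpos
    linarith
  · have hdτ : 0 < s ^ 2 + τ * s + d := by
      have : 0 < τ := by linarith
      positivity
    have hvv : 0 < inner ℝ v v := real_inner_self_pos.2 hv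
    have hne : d ≠ s ^ 2 := by
      rintro rfl
      refine hsD (Module.End.hasEigenvalue_of_hasEigenvector (x := v)
        (Module.End.hasEigenvector_iff.2 ⟨Module.End.mem_eigenspace_iff.2 hdv, hv⟩))
    have hval : ∀ σ : ℝ, σ ^ 2 = 1 → ∃ w,
        s ^ 4 * schurCohnForm ((s⁻¹ ^ 2) • D) (s⁻¹ • t) X (s⁻¹ • X.comp T) w w =
          2 * (s ^ 2 - d) * (σ * τ * s - s ^ 2 - d) * inner ℝ v v := by
      intro σ hσ
      obtain ⟨w, hw1, hw2⟩ := hsurj v ((σ * s) • v)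
      refine ⟨w, ?_⟩
      rw [schurCohnForm_apply]
      simp only [smul_apply, ContinuousLinearMap.comp_apply, hw1, hw2, map_smul, hdv, htv,
        inner_sub_left, inner_add_right, inner_smul_left, inner_smul_right, conj_trivial]
      field_simp
      linear_combination (-(s ^ 2 + d)) * hσ
    have hs4 : 0 < s ^ 4 := by positivity
    rcases lt_or_gt_of_ne hne with hlt | hlt
    · obtain ⟨w, hw⟩ := hval 1 (by norm_num)
      refine ⟨w, pos_of_mul_pos_right (hw ▸ ?_) hs4.le⟩
      exact mul_pos (mul_pos (by linarith) (by linarith)) hvv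
    · obtain ⟨w, hw⟩ := hval (-1) (by norm_num)
      refine ⟨w, pos_of_mul_pos_right (hw ▸ ?_) hs4.le⟩
      exact mul_pos (mul_pos_of_neg_of_neg (by linarith) (by linarith)) hvv

end SchurCohn

section Inna

theorem contDiff_gradient_s7 {E : Type*} [NormedAddCommGroup E] [InnerProductSpace ℝ E]
    [CompleteSpace E] {J : E → ℝ} (hJ : ContDiff ℝ 2 J) : ContDiff ℝ 1 (gradient J) :=
  (InnerProductSpace.toDual ℝ E).symm.toContinuousLinearEquiv.contDiff.comp
    (hJ.fderiv_right (m := 1) (by norm_num))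

theorem inner_fderiv_gradient {E : Type*} [NormedAddCommGroup E] [InnerProductSpace ℝ E]
    [CompleteSpace E] {J : E → ℝ} (hJ : ContDiff ℝ 2 J) (x v w : E) :
    inner ℝ (fderiv ℝ (gradient J) x v) w = fderiv ℝ (fderiv ℝ J) x v w := by
  have h : HasFDerivAt (fderiv ℝ J) (fderiv ℝ (fderiv ℝ J) x) x :=
    ((hJ.fderiv_right (m := 1) (by norm_num)).differentiable one_ne_zero x).hasFDerivAt
  have hG : HasFDerivAt (gradient J) (fderiv ℝ (gradient J) x) x :=
    ((contDiff_gradient_s7 hJ).differentiable one_ne_zero x).hasFDerivAt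
  have heq : (fun y => inner ℝ (gradient J y) w) = fun y => fderiv ℝ J y w :=
    funext fun y => InnerProductSpace.toDual_symm_apply
  have h1 := hG.inner ℝ (hasFDerivAt_const w x)
  rw [heq] at h1
  simpa using congrArg (fun A => A v) (h1.unique (h.clm_apply (hasFDerivAt_const w x)))

/-- The Hessian of a `C²` function is symmetric. -/
theorem inner_fderiv_gradient_comm {E : Type*} [NormedAddCommGroup E] [InnerProductSpace ℝ E]
    [CompleteSpace E] {J : E → ℝ} (hJ : ContDiff ℝ 2 J) (x v w : E) :
    inner ℝ (fderiv ℝ (gradient J) x v) w = inner ℝ v (fderiv ℝ (gradient J) x w) := by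
  rw [inner_fderiv_gradient hJ, real_inner_comm, inner_fderiv_gradient hJ]
  exact hJ.contDiffAt.isSymmSndFDerivAt (by simp) v w

theorem inner_fderiv_self_le_of_lipschitz {E : Type*} [NormedAddCommGroup E]
    [InnerProductSpace ℝ E] {f : E → E} {L : ℝ} (hL : 0 ≤ L) (hf : LipschitzWith L.toNNReal f)
    (x v : E) : inner ℝ (fderiv ℝ f x v) v ≤ L * inner ℝ v v := by
  have h : ‖fderiv ℝ f x‖ ≤ L := by
    simpa [hL] using norm_fderiv_le_of_lipschitz ℝ hf (x₀ := x)
  calc inner ℝ (fderiv ℝ f x v) v ≤ ‖fderiv ℝ f x v‖ * ‖v‖ := real_inner_le_norm _ _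
    _ ≤ L * ‖v‖ * ‖v‖ := by gcongr; exact (fderiv ℝ f x).le_of_opNorm_le h v
    _ = L * inner ℝ v v := by rw [real_inner_self_eq_norm_mul_norm, mul_assoc]

/-- The step-size condition makes the determinant of the INNA Jacobian positive. -/
theorem inna_stepsize_pos {L α β γ : ℝ} (hL : 0 < L)
    (h : γ < β / 2 + α / (2 * L) - Real.sqrt ((α + β * L) ^ 2 - 4 * L) / (2 * L)) :
    0 < 1 - γ * α - γ * (β - γ) * L := by
  have h1 : Real.sqrt ((α + β * L) ^ 2 - 4 * L) < α + β * L - 2 * L * γ := by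
    have h0 : β / 2 + α / (2 * L) - Real.sqrt ((α + β * L) ^ 2 - 4 * L) / (2 * L) =
        (α + β * L - Real.sqrt ((α + β * L) ^ 2 - 4 * L)) / (2 * L) := by
      field_simp
      ring
    rw [h0, lt_div_iff₀ (by positivity)] at h
    linarith
  have h2 := Real.lt_sq_of_sqrt_lt h1
  have h3 : 0 < 4 * L * (1 - γ * α - γ * (β - γ) * L) := by linarith
  exact pos_of_mul_pos_right h3 (by positivity)

variable {E : Type*} [NormedAddCommGroup E] [NormedSpace ℝ E]

/-- The Jacobian of the INNA step, in terms of the Hessian `H` of the objective. -/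
noncomputable def innaJacobian (H : E →L[ℝ] E) (α β γ : ℝ) : E × E →L[ℝ] E × E :=
  (.fst ℝ E E + γ • (-(α - 1 / β) • .fst ℝ E E - (1 / β) • .snd ℝ E E -
      β • H.comp (.fst ℝ E E))).prod
    (.snd ℝ E E + γ • (-(α - 1 / β) • .fst ℝ E E - (1 / β) • .snd ℝ E E))

theorem fst_innaJacobian_sq (H : E →L[ℝ] E) {α β γ : ℝ} (hβ : β ≠ 0) (z : E × E) :
    (innaJacobian H α β γ (innaJacobian H α β γ z)).1 =
      ((2 - γ * α) • (innaJacobian H α β γ z).1 - (γ * β) • H (innaJacobian H α β γ z).1) -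
        ((1 - γ * α) • z.1 - (γ * (β - γ)) • H z.1) := by
  simp only [innaJacobian, ContinuousLinearMap.prod_apply, add_apply, sub_apply, smul_apply,
    ContinuousLinearMap.comp_apply, ContinuousLinearMap.coe_fst', ContinuousLinearMap.coe_snd',
    map_add, map_sub, map_smul]
  match_scalars <;> field_simp <;> ring

theorem eq_zero_of_fst_innaJacobian (H : E →L[ℝ] E) {α β γ : ℝ} (hβ : β ≠ 0) (hγ : γ ≠ 0)
    {z : E × E} (h0 : z.1 = 0) (h1 : (innaJacobian H α β γ z).1 = 0) : z = 0 := by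
  simp [innaJacobian, h0, hβ, hγ] at h1
  exact Prod.ext h0 h1

theorem exists_fst_innaJacobian (H : E →L[ℝ] E) {α β γ : ℝ} (hβ : β ≠ 0) (hγ : γ ≠ 0) (a b : E) :
    ∃ z : E × E, z.1 = a ∧ (innaJacobian H α β γ z).1 = b := by
  refine ⟨(a, (β / γ) • (a - b) + β • (-(α - 1 / β) • a - β • H a)), rfl, ?_⟩
  simp only [innaJacobian, ContinuousLinearMap.prod_apply, add_apply, sub_apply, smul_apply,
    ContinuousLinearMap.comp_apply, ContinuousLinearMap.coe_fst', ContinuousLinearMap.coe_snd']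
  match_scalars <;> field_simp <;> ring

variable {P : ℕ} {J : EuclideanSpace ℝ (Fin P) → ℝ}

theorem contDiff_innaStep (hJ : ContDiff ℝ 2 J) (α β γ : ℝ) : ContDiff ℝ 1 (innaStep J α β γ) := by
  have := contDiff_gradient_s7 hJ
  unfold innaStep
  fun_prop

theorem hasFDerivAt_innaStep (hJ : ContDiff ℝ 2 J) (α β γ : ℝ)
    (p : EuclideanSpace ℝ (Fin P) × EuclideanSpace ℝ (Fin P)) :
    HasFDerivAt (innaStep J α β γ) (innaJacobian (fderiv ℝ (gradient J) p.1) α β γ) p := by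
  have hG : HasFDerivAt (fun p : EuclideanSpace ℝ (Fin P) × EuclideanSpace ℝ (Fin P) =>
      gradient J p.1) _ p :=
    HasFDerivAt.comp (g := gradient J) p
      ((contDiff_gradient_s7 hJ).differentiable one_ne_zero p.1).hasFDerivAt hasFDerivAt_fst
  have hy := (hasFDerivAt_fst (𝕜 := ℝ) (p := p)).const_smul (-(α - 1 / β)) |>.sub
    ((hasFDerivAt_snd (𝕜 := ℝ) (p := p)).const_smul (1 / β))
  exact (hasFDerivAt_fst.add ((hy.sub (hG.const_smul β)).const_smul γ)).prodMk
    (hasFDerivAt_snd.add (hy.const_smul γ))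

end Inna

/-- Theorem 4 of the paper.
Let `J : ℝ^P → ℝ` be twice continuously differentiable, lower bounded, with isolated
critical points and `L`-Lipschitz gradient.  Let `α > 0`, `β > 0` and
`0 < γ < min (β/2 + α/(2L) − √((α + βL)² − 4L)/(2L)) β`.  Then the set of
initializations such that the INNA iterates converge to a point of `S_{<0}` has
Lebesgue measure zero. -/
theorem inna_avoids_strict_saddles (P : ℕ) (J : EuclideanSpace ℝ (Fin P) → ℝ)
    (hJ : ContDiff ℝ 2 J) (hbdd : BddBelow (Set.range J))
    (hiso : ∀ θs : EuclideanSpace ℝ (Fin P), gradient J θs = 0 →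
      ∃ U ∈ 𝓝 θs, ∀ θ ∈ U, gradient J θ = 0 → θ = θs)
    (L : ℝ) (hL : 0 < L) (hlip : LipschitzWith (Real.toNNReal L) (gradient J))
    (α β γ : ℝ) (hα : 0 < α) (hβ : 0 < β) (hγ : 0 < γ)
    (hγ' : γ < min (β / 2 + α / (2 * L) - Real.sqrt ((α + β * L) ^ 2 - 4 * L) / (2 * L)) β) :
    volume {p : EuclideanSpace ℝ (Fin P) × EuclideanSpace ℝ (Fin P) |
      ∃ q : EuclideanSpace ℝ (Fin P) × EuclideanSpace ℝ (Fin P),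
        IsStrictSaddleStationaryPoint J α β q ∧
        Tendsto (fun k => (innaStep J α β γ)^[k] p) atTop (𝓝 q)} = 0 := by
  obtain ⟨hγ1, hγβ⟩ := lt_min_iff.1 hγ'
  have hdet := inna_stepsize_pos hL hγ1
  have hC1 := contDiff_innaStep hJ α β γ
  let H := fun x => fderiv ℝ (gradient J) x
  let D := fun x => (1 - γ * α) • ContinuousLinearMap.id ℝ (EuclideanSpace ℝ (Fin P)) -
    (γ * (β - γ)) • H x
  let t := fun x => (2 - γ * α) • ContinuousLinearMap.id ℝ (EuclideanSpace ℝ (Fin P)) -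
    (γ * β) • H x
  have hDpos : ∀ x v, v ≠ 0 → 0 < inner ℝ (D x v) v := by
    intro x v hv
    have hle := inner_fderiv_self_le_of_lipschitz hL.le hlip x v
    have hmul := mul_le_mul_of_nonneg_left hle (mul_pos hγ (sub_pos.2 hγβ)).le
    have := mul_pos hdet (real_inner_self_pos.2 hv)
    simp only [D, H, sub_apply, smul_apply, ContinuousLinearMap.id_apply, inner_sub_left,
      real_inner_smul_left]
    linarith
  have hrec := fun x => fst_innaJacobian_sq (H x) (α := α) (γ := γ) hβ.ne'
  have hinj : ∀ p, Function.Injective (fderiv ℝ (innaStep J α β γ) p) := by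
    intro p
    rw [(hasFDerivAt_innaStep hJ α β γ p).fderiv, injective_iff_map_eq_zero]
    intro z hz
    have h1 := hrec p.1 z
    rw [show innaJacobian (H p.1) α β γ z = 0 from hz] at h1
    simp only [map_zero, Prod.fst_zero, smul_zero, sub_zero, zero_sub] at h1
    have hD0 : D p.1 z.1 = 0 := neg_eq_zero.1 h1.symm
    refine eq_zero_of_fst_innaJacobian (H p.1) hβ.ne' hγ.ne' ?_ (congrArg Prod.fst hz)
    by_contra h0
    simpa [hD0] using hDpos p.1 z.1 h0
  have : (volume : Measure (EuclideanSpace ℝ (Fin P) × EuclideanSpace ℝ (Fin P))).IsAddHaarMeasure :=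
    Measure.prod.instIsAddHaarMeasure _ _
  refine addHaar_tendsto_iterate_eq_zero volume hC1 hinj
    (S := {q | IsStrictSaddleStationaryPoint J α β q}) ?_
  rintro q ⟨hcrit, hq2, lam, v, hv, hlam, heig⟩
  have hDv : D q.1 v = (1 - γ * α - γ * (β - γ) * lam) • v := by
    simp only [D, H, sub_apply, smul_apply, ContinuousLinearMap.id_apply, heig]
    module
  have htv : t q.1 v = (2 - γ * α - γ * β * lam) • v := by
    simp only [t, H, sub_apply, smul_apply, ContinuousLinearMap.id_apply, heig]
    module
  have hd : 0 < 1 - γ * α - γ * (β - γ) * lam := by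
    have := hDpos q.1 v hv
    rw [hDv, real_inner_smul_left] at this
    exact pos_of_mul_pos_left this real_inner_self_nonneg
  obtain ⟨B, a, ha, hB, w, hw⟩ := exists_expanding_form (D := D q.1) (t := t q.1)
    (T := innaJacobian (H q.1) α β γ) (X := .fst ℝ _ _)
    (fun x y => by
      simp [D, H, inner_sub_left, inner_sub_right, real_inner_smul_left, real_inner_smul_right,
        inner_fderiv_gradient_comm hJ])
    (fun x y => by
      simp [t, H, inner_sub_left, inner_sub_right, real_inner_smul_left, real_inner_smul_right,
        inner_fderiv_gradient_comm hJ])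
    (fun x => by
      simp only [D, t, sub_apply, smul_apply, ContinuousLinearMap.id_apply, map_sub, map_smul]
      module)
    (hrec q.1) (fun z => eq_zero_of_fst_innaJacobian (H q.1) hβ.ne' hγ.ne')
    (exists_fst_innaJacobian (H q.1) hβ.ne' hγ.ne') hv hDv htv hd
    (by nlinarith [mul_pos (mul_pos hγ hγ) (neg_pos.2 hlam)])
  have hfix : innaStep J α β γ q = q := by
    refine Prod.ext ?_ ?_ <;> simp only [innaStep, hcrit, hq2] <;> match_scalars <;> field_simp <;>
      ring
  have hstrict : HasStrictFDerivAt (innaStep J α β γ) (innaJacobian (H q.1) α β γ) q :=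
    hC1.contDiffAt.hasStrictFDerivAt' (hasFDerivAt_innaStep hJ α β γ q) one_ne_zero
  have hstrict2 : HasStrictFDerivAt (innaStep J α β γ)^[2]
      ((innaJacobian (H q.1) α β γ).comp (innaJacobian (H q.1) α β γ)) q :=
    HasStrictFDerivAt.comp (g := innaStep J α β γ) q (by rwa [hfix]) hstrict
  obtain ⟨U, hU, hμ⟩ := exists_nhds_addHaar_stay_eq_zero volume (hC1.continuous.iterate 2)
    hstrict2 B ha hB hw
  refine ⟨U, hU, measure_mono_null (Set.ofPred_subset_ofPred.2 fun x hx k => ?_) hμ⟩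
  rw [← Function.iterate_mul]
  exact hx (2 * k)
end

section
/- Let J : ℝ^P → ℝ be twice continuously differentiable, lower bounded, with L-Lipschitz continuous gradient for some L > 0, and let α > 0, β > 0. Let (θ_k, ψ_k)_{k∈ℕ} be the INNA sequence from any initialization, with step-size γ satisfying 0 < γ < min(2α/((1 + αβ)L + α²), 1/α + β, 2β). Then the sequence (J(θ_k))_{k∈ℕ} converges and ‖∇J(θ_k)‖² → 0 as k → ∞. If in addition (θ_k)_{k∈ℕ} is bounded and the critical points of J are isolated, then (θ_k)_{k∈ℕ} converges to a critical point of J. -/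
open Filter Topology

/-- The descent lemma for functions with Lipschitz gradient. -/
theorem descent_of_lipschitz_gradient {E : Type*} [NormedAddCommGroup E] [InnerProductSpace ℝ E]
    [CompleteSpace E] {f : E → ℝ} {K : NNReal} (hf : Differentiable ℝ f)
    (hlip : LipschitzWith K (gradient f)) (x d : E) :
    f (x + d) ≤ f x + inner ℝ (gradient f x) d + K / 2 * ‖d‖ ^ 2 := by
  have hder : ∀ t : ℝ, HasDerivAt (fun t : ℝ => t * inner ℝ (gradient f x) d
      + K / 2 * ‖d‖ ^ 2 * t ^ 2 - f (x + t • d))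
      (inner ℝ (gradient f x) d + K * ‖d‖ ^ 2 * t - inner ℝ (gradient f (x + t • d)) d) t := by
    intro t
    have h1 : HasDerivAt (fun t : ℝ => x + t • d) d t := by
      simpa using ((hasDerivAt_id t).smul_const d).const_add x
    have h2 := (hf (x + t • d)).hasGradientAt.hasFDerivAt.comp_hasDerivAt t h1
    rw [InnerProductSpace.toDual_apply_apply] at h2
    have h3 := (((hasDerivAt_id t).mul_const (inner ℝ (gradient f x) d)).add
      (((hasDerivAt_id t).pow 2).const_mul (K / 2 * ‖d‖ ^ 2))).sub h2
    refine h3.congr_deriv ?_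
    simp
    ring
  have hmono : MonotoneOn (fun t : ℝ => t * inner ℝ (gradient f x) d
      + K / 2 * ‖d‖ ^ 2 * t ^ 2 - f (x + t • d)) (Set.Ici 0) := by
    refine monotoneOn_of_deriv_nonneg (convex_Ici 0)
      (fun t _ => (hder t).continuousAt.continuousWithinAt)
      (fun t _ => (hder t).differentiableAt.differentiableWithinAt) fun t ht => ?_
    rw [interior_Ici, Set.mem_Ioi] at ht
    rw [(hder t).deriv]
    have h4 := real_inner_le_norm (gradient f (x + t • d) - gradient f x) d
    have h5 := hlip.norm_sub_le (x + t • d) x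
    rw [add_sub_cancel_left, norm_smul, Real.norm_of_nonneg ht.le] at h5
    rw [inner_sub_left] at h4
    nlinarith [mul_le_mul_of_nonneg_right h5 (norm_nonneg d)]
  have h := hmono Set.self_mem_Ici (Set.mem_Ici.2 zero_le_one) zero_le_one
  simp [-inner_gradient_left] at h
  linarith

/-- A nonnegative sequence dominated by the decrements of a lower bounded sequence tends to `0`. -/
theorem tendsto_zero_of_le_sub_succ {E r : ℕ → ℝ} {c : ℝ} (hE : Tendsto E atTop (𝓝 c))
    (hr : ∀ k, 0 ≤ r k) (h : ∀ k, r k ≤ E k - E (k + 1)) : Tendsto r atTop (𝓝 0) := by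
  refine squeeze_zero hr h ?_
  simpa using hE.sub (hE.comp (tendsto_add_atTop_nat 1))

/-- If the increments of a sequence and the values of a continuous map along it tend to `0`, then
the sequence converges to any of its cluster points that is an isolated zero of the map. -/
theorem tendsto_of_mapClusterPt_of_isolated_zero {E F : Type*} [NormedAddCommGroup E]
    [ProperSpace E] [NormedAddCommGroup F] {G : E → F} (hG : Continuous G) {x : ℕ → E} {a : E}
    (hstep : Tendsto (fun k => dist (x (k + 1)) (x k)) atTop (𝓝 0))
    (hGx : Tendsto (fun k => ‖G (x k)‖) atTop (𝓝 0)) (ha : MapClusterPt a atTop x)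
    (hiso : ∀ᶠ y in 𝓝 a, G y = 0 → y = a) : Tendsto x atTop (𝓝 a) := by
  obtain ⟨r, hr, hrU⟩ := Metric.eventually_nhds_iff.1 hiso
  rw [Metric.tendsto_atTop']
  intro ε₀ hε₀
  obtain ⟨ε, hε, hεr, hεε⟩ : ∃ ε > 0, ε < r ∧ ε < ε₀ :=
    ⟨min r ε₀ / 2, by positivity,
      (half_lt_self (lt_min hr hε₀)).trans_le (min_le_left _ _),
      (half_lt_self (lt_min hr hε₀)).trans_le (min_le_right _ _)⟩
  set A : Set E := Metric.closedBall a ε \ Metric.ball a (ε / 2)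
  have hAc : IsCompact A := (isCompact_closedBall a ε).diff Metric.isOpen_ball
  have hAG : ∀ y ∈ A, 0 < ‖G y‖ := by
    rintro y ⟨hy1, hy2⟩
    refine norm_pos_iff.2 fun h0 => hy2 ?_
    rw [hrU ((Metric.mem_closedBall.1 hy1).trans_lt hεr) h0]
    exact Metric.mem_ball_self (half_pos hε)
  obtain ⟨m, hm, hmA⟩ : ∃ m > 0, ∀ y ∈ A, m ≤ ‖G y‖ := by
    obtain ⟨m, hm, h⟩ := hAc.exists_forall_le' hG.norm.continuousOn hAG
    exact ⟨m, hm, h⟩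
  obtain ⟨N, hN⟩ := eventually_atTop.1
    ((hstep.eventually_lt_const (half_pos hε)).and (hGx.eventually_lt_const hm))
  obtain ⟨n, hnN, hn⟩ := frequently_atTop.1
    (ha.frequently (Metric.ball_mem_nhds a (half_pos hε))) N
  have hball : ∀ k, n ≤ k → dist (x k) a < ε / 2 := by
    intro k hk
    induction k, hk using Nat.le_induction with
    | base => exact hn
    | succ k hk ih =>
      by_contra hout
      have hd := (hN k (hnN.trans hk)).1
      have hcl : dist (x (k + 1)) a ≤ ε := by
        linarith [dist_triangle (x (k + 1)) (x k) a]
      exact (hmA _ ⟨hcl, hout⟩).not_gt (hN (k + 1) (by omega)).2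
  exact ⟨n, fun k hk => by linarith [hball k hk.le]⟩

/-- Theorem 5 of the paper.
Let `J : ℝ^P → ℝ` be twice continuously differentiable, lower bounded, with
`L`-Lipschitz gradient, `α > 0`, `β > 0`, and let `(θ_k, ψ_k)` be INNA iterates with
step-size `0 < γ < min (2α/((1 + αβ)L + α²)) (1/α + β) (2β)`.  Then `(J(θ_k))`
converges and `‖∇J(θ_k)‖² → 0`.  If in addition `(θ_k)` is bounded and the critical
points of `J` are isolated, then `(θ_k)` converges to a critical point of `J`. -/
theorem inna_convergence (P : ℕ) (J : EuclideanSpace ℝ (Fin P) → ℝ)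
    (hJ : ContDiff ℝ 2 J) (hbdd : BddBelow (Set.range J))
    (L : ℝ) (hL : 0 < L) (hlip : LipschitzWith (Real.toNNReal L) (gradient J))
    (α β γ : ℝ) (hα : 0 < α) (hβ : 0 < β) (hγ : 0 < γ)
    (hγ' : γ < min (2 * α / ((1 + α * β) * L + α ^ 2)) (min (1 / α + β) (2 * β)))
    (θ ψ : ℕ → EuclideanSpace ℝ (Fin P))
    (hθ : ∀ k, θ (k + 1) =
      θ k + γ • (-(α - 1 / β) • θ k - (1 / β) • ψ k - β • gradient J (θ k)))
    (hψ : ∀ k, ψ (k + 1) = ψ k + γ • (-(α - 1 / β) • θ k - (1 / β) • ψ k)) :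
    (∃ c : ℝ, Tendsto (fun k => J (θ k)) atTop (𝓝 c)) ∧
    Tendsto (fun k => ‖gradient J (θ k)‖ ^ 2) atTop (𝓝 0) ∧
    ((Bornology.IsBounded (Set.range θ) ∧
        (∀ θs : EuclideanSpace ℝ (Fin P), gradient J θs = 0 →
          ∃ U ∈ 𝓝 θs, ∀ θ' ∈ U, gradient J θ' = 0 → θ' = θs)) →
      ∃ θs : EuclideanSpace ℝ (Fin P),
        gradient J θs = 0 ∧ Tendsto θ atTop (𝓝 θs)) := by
  obtain ⟨hγ1, hγ2⟩ := lt_min_iff.1 hγ'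
  obtain ⟨hγ2, hγ3⟩ := lt_min_iff.1 hγ2
  have hD : 0 < (1 + α * β) * L + α ^ 2 := by positivity
  rw [lt_div_iff₀ hD] at hγ1
  have hc : 0 < 1 + α * β - γ * α := by
    have h := mul_lt_mul_of_pos_right hγ2 hα
    have h' : (1 / α + β) * α = 1 + α * β := by field_simp
    linarith
  have hdiff : Differentiable ℝ J := hJ.differentiable (by norm_num)
  set g : ℕ → EuclideanSpace ℝ (Fin P) := fun k => gradient J (θ k)
  set u : ℕ → EuclideanSpace ℝ (Fin P) :=
    fun k => -(α - 1 / β) • θ k - (1 / β) • ψ k with hu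
  set d : ℕ → EuclideanSpace ℝ (Fin P) := fun k => u k - β • g k with hd
  have hθd : ∀ k, θ (k + 1) = θ k + γ • d k := hθ
  have hψu : ∀ k, ψ (k + 1) = ψ k + γ • u k := hψ
  have hud : ∀ k, u k = d k + β • g k := fun k => by simp [hd]
  have husucc : ∀ k, u (k + 1) = d k + β • g k - γ • (α • d k + g k) := by
    intro k
    rw [← hud k]
    have h1 : u (k + 1) = u k - (α - 1 / β) • γ • d k - (1 / β) • γ • u k := by
      simp only [hu]
      rw [hθd, hψu]
      module
    rw [h1, hud k]
    match_scalars <;> field_simp <;> ring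
  set E : ℕ → ℝ := fun k => (1 + α * β - γ * α) * J (θ k) + 1 / 2 * ‖u k‖ ^ 2 with hE
  set a : ℝ := γ * α - γ ^ 2 / 2 * ((1 + α * β) * L + α ^ 2) with ha
  set b : ℝ := γ * β - γ ^ 2 / 2 with hb
  have ha0 : 0 < a := by
    have : a = γ / 2 * (2 * α - γ * ((1 + α * β) * L + α ^ 2)) := by rw [ha]; ring
    rw [this]
    exact mul_pos (half_pos hγ) (sub_pos.2 hγ1)
  have hb0 : 0 < b := by
    have : b = γ / 2 * (2 * β - γ) := by rw [hb]; ring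
    rw [this]
    exact mul_pos (half_pos hγ) (sub_pos.2 hγ3)
  have hdec : ∀ k, a * ‖d k‖ ^ 2 + b * ‖g k‖ ^ 2 ≤ E k - E (k + 1) := by
    intro k
    have h1 := descent_of_lipschitz_gradient hdiff hlip (θ k) (γ • d k)
    rw [← hθd, Real.coe_toNNReal L hL.le, inner_smul_right, norm_smul,
      Real.norm_of_nonneg hγ.le] at h1
    change J (θ (k + 1)) ≤ J (θ k) + γ * inner ℝ (g k) (d k) + L / 2 * (γ * ‖d k‖) ^ 2 at h1
    have h2 := mul_le_mul_of_nonneg_left h1 hc.le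
    have h3 : ‖u k‖ ^ 2 = ‖d k‖ ^ 2 + 2 * β * inner ℝ (g k) (d k) + β ^ 2 * ‖g k‖ ^ 2 := by
      rw [hud k]
      simp only [← real_inner_self_eq_norm_sq, inner_add_left, inner_add_right,
        real_inner_smul_left, real_inner_smul_right, real_inner_comm (g k) (d k)]
      ring
    have h4 : ‖u (k + 1)‖ ^ 2 = (1 - γ * α) ^ 2 * ‖d k‖ ^ 2
        + 2 * (1 - γ * α) * (β - γ) * inner ℝ (g k) (d k) + (β - γ) ^ 2 * ‖g k‖ ^ 2 := by
      have : u (k + 1) = (1 - γ * α) • d k + (β - γ) • g k := by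
        rw [husucc]
        module
      rw [this]
      simp only [← real_inner_self_eq_norm_sq, inner_add_left, inner_add_right,
        real_inner_smul_left, real_inner_smul_right, real_inner_comm (g k) (d k)]
      ring
    have h5 : 0 ≤ γ ^ 3 * α * L / 2 * ‖d k‖ ^ 2 := by positivity
    simp only [hE, h3, h4, ha, hb]
    linarith
  obtain ⟨B, hB⟩ := hbdd
  have hBJ : ∀ x, B ≤ J x := fun x => hB ⟨x, rfl⟩
  have hEanti : Antitone E := antitone_nat_of_succ_le fun k => by
    have : 0 ≤ a * ‖d k‖ ^ 2 + b * ‖g k‖ ^ 2 := by positivity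
    linarith [hdec k]
  have hElim : Tendsto E atTop (𝓝 (⨅ k, E k)) := by
    refine tendsto_atTop_ciInf hEanti ⟨(1 + α * β - γ * α) * B, ?_⟩
    rintro _ ⟨k, rfl⟩
    have h1 := mul_le_mul_of_nonneg_left (hBJ (θ k)) hc.le
    have h2 : 0 ≤ 1 / 2 * ‖u k‖ ^ 2 := by positivity
    simp only [hE]
    linarith
  have hd0 : Tendsto (fun k => ‖d k‖ ^ 2) atTop (𝓝 0) := by
    have h := tendsto_zero_of_le_sub_succ (r := fun k => a * ‖d k‖ ^ 2) hElim
      (fun k => by positivity) fun k => by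
        have : 0 ≤ b * ‖g k‖ ^ 2 := by positivity
        linarith [hdec k]
    simpa [← mul_assoc, inv_mul_cancel₀ ha0.ne'] using h.const_mul a⁻¹
  have hg0 : Tendsto (fun k => ‖g k‖ ^ 2) atTop (𝓝 0) := by
    have h := tendsto_zero_of_le_sub_succ (r := fun k => b * ‖g k‖ ^ 2) hElim
      (fun k => by positivity) fun k => by
        have : 0 ≤ a * ‖d k‖ ^ 2 := by positivity
        linarith [hdec k]
    simpa [← mul_assoc, inv_mul_cancel₀ hb0.ne'] using h.const_mul b⁻¹
  have hd1 : Tendsto (fun k => ‖d k‖) atTop (𝓝 0) := by simpa using hd0.sqrt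
  have hg1 : Tendsto (fun k => ‖g k‖) atTop (𝓝 0) := by simpa using hg0.sqrt
  have hu1 : Tendsto u atTop (𝓝 0) := by
    rw [funext hud]
    simpa using (tendsto_zero_iff_norm_tendsto_zero.2 hd1).add
      ((tendsto_zero_iff_norm_tendsto_zero.2 hg1).const_smul β)
  refine ⟨⟨(1 + α * β - γ * α)⁻¹ * ((⨅ k, E k) - 1 / 2 * ‖(0 : EuclideanSpace ℝ (Fin P))‖ ^ 2),
    ?_⟩, hg0, ?_⟩
  · refine ((hElim.sub ((hu1.norm.pow 2).const_mul (1 / 2))).const_mul _).congr fun k => ?_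
    rw [inv_mul_eq_iff_eq_mul₀ hc.ne']
    simp only [hE]
    ring
  · rintro ⟨hbounded, hiso⟩
    obtain ⟨θs, -, φ, hφ, hlim⟩ := tendsto_subseq_of_bounded hbounded fun k => Set.mem_range_self k
    have hcrit : gradient J θs = 0 :=
      tendsto_nhds_unique ((hlip.continuous.tendsto θs).comp hlim)
        ((tendsto_zero_iff_norm_tendsto_zero.2 hg1).comp hφ.tendsto_atTop)
    refine ⟨θs, hcrit, tendsto_of_mapClusterPt_of_isolated_zero hlip.continuous ?_ hg1
      (hlim.mapClusterPt.of_comp hφ.tendsto_atTop) ?_⟩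
    · simpa [hθd, norm_smul] using hd1.const_mul |γ|
    · obtain ⟨U, hU, h⟩ := hiso θs hcrit
      exact mem_of_superset hU h
end

section
/- Let J : ℝ^P → ℝ be twice continuously differentiable with L-Lipschitz continuous gradient for some L > 0, let α > 0, β > 0, and let 0 < γ < min(β/2 + α/(2L) − √((α + βL)² − 4L)/(2L), β). Then the map G : ℝ^P × ℝ^P → ℝ^P × ℝ^P defined by G(θ, ψ) = (θ + γ[−(α − 1/β)θ − (1/β)ψ − β∇J(θ)], ψ + γ[−(α − 1/β)θ − (1/β)ψ]) is a local diffeomorphism; equivalently, its Jacobian matrix DG(θ, ψ) is invertible at every point (θ, ψ) ∈ ℝ^P × ℝ^P. -/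
/-- Below the smaller root (or anywhere, if there are no real roots) the quadratic
`L γ² - (α + β L) γ + 1` is positive. -/
theorem quadratic_pos_of_lt_root {L α β γ : ℝ} (hL : 0 < L)
    (h : γ < β / 2 + α / (2 * L) - Real.sqrt ((α + β * L) ^ 2 - 4 * L) / (2 * L)) :
    0 < L * γ ^ 2 - (α + β * L) * γ + 1 := by
  have hlt : Real.sqrt ((α + β * L) ^ 2 - 4 * L) < α + β * L - 2 * L * γ := by
    have key := mul_lt_mul_of_pos_right h (by positivity : 0 < 2 * L)
    have hcancel : (β / 2 + α / (2 * L) - Real.sqrt ((α + β * L) ^ 2 - 4 * L) / (2 * L)) * (2 * L)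
        = β * L + α - Real.sqrt ((α + β * L) ^ 2 - 4 * L) := by
      field_simp
    linarith
  have hsq := Real.lt_sq_of_sqrt_lt hlt
  have : 0 < 4 * L * (L * γ ^ 2 - (α + β * L) * γ + 1) := by linarith
  exact pos_of_mul_pos_right this (by positivity)

/-- The gradient of a `C²` function on a Hilbert space is differentiable. -/
theorem ContDiff.differentiable_gradient {E : Type*} [NormedAddCommGroup E]
    [InnerProductSpace ℝ E] [CompleteSpace E] {J : E → ℝ} (hJ : ContDiff ℝ 2 J) :
    Differentiable ℝ (gradient J) :=
  (InnerProductSpace.toDual ℝ E).symm.toContinuousLinearEquiv.differentiable.comp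
    ((hJ.fderiv_right (m := 1) (by norm_num)).differentiable one_ne_zero)

/-- If `c ‖H‖ ≤ c L < d`, then `d u = c H u` forces `u = 0`. -/
theorem eq_zero_of_smul_eq_smul_apply {E : Type*} [NormedAddCommGroup E] [NormedSpace ℝ E]
    {H : E →L[ℝ] E} {L c d : ℝ} (hH : ‖H‖ ≤ L) (hc : 0 ≤ c) (hd : c * L < d) {u : E}
    (hu : d • u = c • H u) : u = 0 := by
  have hle : d * ‖u‖ ≤ c * L * ‖u‖ := calc
    d * ‖u‖ ≤ |d| * ‖u‖ := by gcongr; exact le_abs_self d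
    _ = ‖c • H u‖ := by rw [← hu, norm_smul, Real.norm_eq_abs]
    _ = c * ‖H u‖ := by rw [norm_smul, Real.norm_of_nonneg hc]
    _ ≤ c * (L * ‖u‖) := by gcongr; exact H.le_of_opNorm_le hH u
    _ = c * L * ‖u‖ := by ring
  by_contra hne
  nlinarith [norm_pos_iff.mpr hne]

/-- An injective derivative of a self-map of a finite-dimensional space is an equivalence. -/
theorem HasFDerivAt.exists_equiv_of_injective {E : Type*} [NormedAddCommGroup E]
    [NormedSpace ℝ E] [FiniteDimensional ℝ E] {f : E → E} {f' : E →L[ℝ] E} {x : E}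
    (hf : HasFDerivAt f f' x) (hinj : Function.Injective f') :
    ∃ D : E ≃L[ℝ] E, HasFDerivAt f (D : E →L[ℝ] E) x :=
  ⟨(LinearEquiv.ofInjectiveEndo f'.toLinearMap hinj).toContinuousLinearEquiv, hf⟩

/-- Theorem 6 of the paper.
Let `J : ℝ^P → ℝ` be twice continuously differentiable with `L`-Lipschitz gradient,
`α > 0`, `β > 0` and `0 < γ < min (β/2 + α/(2L) − √((α + βL)² − 4L)/(2L)) β`.  Then
the INNA update map `G` is a local diffeomorphism: at every point its derivative
exists and is an invertible (continuous) linear map. -/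
theorem inna_local_diffeomorphism (P : ℕ) (J : EuclideanSpace ℝ (Fin P) → ℝ)
    (hJ : ContDiff ℝ 2 J)
    (L : ℝ) (hL : 0 < L) (hlip : LipschitzWith (Real.toNNReal L) (gradient J))
    (α β γ : ℝ) (hα : 0 < α) (hβ : 0 < β) (hγ : 0 < γ)
    (hγ' : γ < min (β / 2 + α / (2 * L) - Real.sqrt ((α + β * L) ^ 2 - 4 * L) / (2 * L)) β) :
    ∀ p : EuclideanSpace ℝ (Fin P) × EuclideanSpace ℝ (Fin P),
      ∃ D : (EuclideanSpace ℝ (Fin P) × EuclideanSpace ℝ (Fin P)) ≃L[ℝ]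
          (EuclideanSpace ℝ (Fin P) × EuclideanSpace ℝ (Fin P)),
        HasFDerivAt (innaStep J α β γ) (D : (EuclideanSpace ℝ (Fin P) ×
          EuclideanSpace ℝ (Fin P)) →L[ℝ] (EuclideanSpace ℝ (Fin P) ×
          EuclideanSpace ℝ (Fin P))) p := by
  intro p
  obtain ⟨hγroot, hγβ⟩ := lt_min_iff.mp hγ'
  have hgrad := (hJ.differentiable_gradient p.1).hasFDerivAt
  set H := fderiv ℝ (gradient J) p.1
  have hH : ‖H‖ ≤ L := by
    simpa [Real.coe_toNNReal L hL.le] using hgrad.le_of_lipschitz hlip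
  have hfst := hasFDerivAt_fst (𝕜 := ℝ) (p := p)
  have hsnd := hasFDerivAt_snd (𝕜 := ℝ) (p := p)
  have hlin := (hfst.const_smul (-(α - 1 / β))).sub (hsnd.const_smul (1 / β))
  have hG := (hfst.add ((hlin.sub ((hgrad.comp p hfst).const_smul β)).const_smul γ)).prodMk
    (hsnd.add (hlin.const_smul γ))
  refine HasFDerivAt.exists_equiv_of_injective (f := innaStep J α β γ) hG ?_
  rw [injective_iff_map_eq_zero]
  rintro ⟨u, v⟩ huv
  obtain ⟨h₁, h₂⟩ := Prod.mk.inj huv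
  replace h₁ : u + γ • (-(α - 1 / β) • u - (1 / β) • v - β • H u) = 0 := h₁
  replace h₂ : v + γ • (-(α - 1 / β) • u - (1 / β) • v) = 0 := h₂
  have hv : v = u - (γ * β) • H u := by
    linear_combination (norm := module) h₂ - h₁
  have hu : (1 - γ * α) • u = (γ * (β - γ)) • H u := by
    rw [hv] at h₂
    have hβ' := hβ.ne'
    linear_combination (norm := skip) h₂
    match_scalars <;> field_simp <;> ring
  have hu0 : u = 0 := by
    refine eq_zero_of_smul_eq_smul_apply hH (mul_nonneg hγ.le (sub_nonneg.mpr hγβ.le)) ?_ hu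
    linarith [quadratic_pos_of_lt_root hL hγroot]
  simp [hv, hu0]
end

section
/- For any α > 0 and β > 0 with αβ > 1, the function x ↦ β/2 + α/(2x) − √((α + βx)² − 4x)/(2x) is continuous and strictly decreasing on (0, ∞), and continuous and strictly decreasing on (−∞, 0). -/
theorem two_div_lt_add_sqrt {α β : ℝ} (hβ : 0 < β) (hαβ : 1 < α * β) (x : ℝ) :
    2 / β < α + β * x + √((α + β * x) ^ 2 - 4 * x) := by
  have h : 2 / β - (α + β * x) < √((α + β * x) ^ 2 - 4 * x) := by
    apply Real.lt_sqrt_of_sq_lt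
    have key : (α + β * x) ^ 2 - 4 * x - (2 / β - (α + β * x)) ^ 2 =
        4 * (α * β - 1) / β ^ 2 := by
      field_simp
      ring
    have : 0 < 4 * (α * β - 1) / β ^ 2 := div_pos (by linarith) (by positivity)
    linarith
  linarith

theorem add_sq_sub_four_mul_nonneg {α β : ℝ} (hβ : 0 < β) (hαβ : 1 < α * β) (x : ℝ) :
    0 ≤ (α + β * x) ^ 2 - 4 * x := by
  have h : 0 ≤ β ^ 2 * ((α + β * x) ^ 2 - 4 * x) := by
    nlinarith [sq_nonneg (β * (α + β * x) - 2)]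
  exact nonneg_of_mul_nonneg_right h (by positivity)

theorem strictMono_add_sqrt {α β : ℝ} (hβ : 0 < β) (hαβ : 1 < α * β) :
    StrictMono fun x : ℝ => α + β * x + √((α + β * x) ^ 2 - 4 * x) := by
  intro x y hxy
  have hx := two_div_lt_add_sqrt hβ hαβ x
  have hy := two_div_lt_add_sqrt hβ hαβ y
  have sx := Real.sq_sqrt (add_sq_sub_four_mul_nonneg hβ hαβ x)
  have sy := Real.sq_sqrt (add_sq_sub_four_mul_nonneg hβ hαβ y)
  by_contra! hle
  set q := α + β * x + √((α + β * x) ^ 2 - 4 * x) with hq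
  set p := α + β * y + √((α + β * y) ^ 2 - 4 * y) with hp
  rw [← sub_eq_iff_eq_add'.mpr hq] at sx
  rw [← sub_eq_iff_eq_add'.mpr hp] at sy
  rw [div_lt_iff₀ hβ] at hx hy
  have ex : q * (q - 2 * α) = 2 * x * (q * β - 2) := by linarith
  have ey : p * (p - 2 * α) = 2 * y * (p * β - 2) := by linarith
  have hup : 0 < p * β - 2 := by linarith
  have huq : 0 < q * β - 2 := by linarith
  have key : 2 * β * (y - x) * ((p * β - 2) * (q * β - 2)) +
      (q - p) * ((p * β - 2) * (q * β - 2) + 4 * (α * β - 1)) = 0 := by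
    linear_combination β * (q * β - 2) * (-ey) + β * (p * β - 2) * ex
  have h₁ : 0 < 2 * β * (y - x) * ((p * β - 2) * (q * β - 2)) :=
    mul_pos (mul_pos (by positivity) (by linarith)) (mul_pos hup huq)
  have h₂ : 0 ≤ (q - p) * ((p * β - 2) * (q * β - 2) + 4 * (α * β - 1)) :=
    mul_nonneg (by linarith) (by linarith [mul_pos hup huq])
  linarith

theorem gamma_minus_eq_two_div {α β : ℝ} (hβ : 0 < β) (hαβ : 1 < α * β) {x : ℝ} (hx : x ≠ 0) :
    β / 2 + α / (2 * x) - √((α + β * x) ^ 2 - 4 * x) / (2 * x) =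
      2 / (α + β * x + √((α + β * x) ^ 2 - 4 * x)) := by
  have hT := (div_pos two_pos hβ).trans (two_div_lt_add_sqrt hβ hαβ x)
  have hs := Real.sq_sqrt (add_sq_sub_four_mul_nonneg hβ hαβ x)
  rw [eq_div_iff hT.ne']
  generalize √((α + β * x) ^ 2 - 4 * x) = s at *
  field_simp
  linear_combination -hs

theorem continuousOn_gamma_minus (α β : ℝ) {t : Set ℝ} (ht : ∀ x ∈ t, x ≠ 0) :
    ContinuousOn
      (fun x : ℝ => β / 2 + α / (2 * x) - √((α + β * x) ^ 2 - 4 * x) / (2 * x)) t := by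
  have h : ∀ x ∈ t, 2 * x ≠ 0 := fun x hx => mul_ne_zero two_ne_zero (ht x hx)
  fun_prop (disch := assumption)

theorem strictAntiOn_gamma_minus {α β : ℝ} (hβ : 0 < β) (hαβ : 1 < α * β) {t : Set ℝ}
    (ht : ∀ x ∈ t, x ≠ 0) :
    StrictAntiOn
      (fun x : ℝ => β / 2 + α / (2 * x) - √((α + β * x) ^ 2 - 4 * x) / (2 * x)) t := by
  intro x hx y hy hxy
  simp only [gamma_minus_eq_two_div hβ hαβ (ht x hx), gamma_minus_eq_two_div hβ hαβ (ht y hy)]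
  exact div_lt_div_of_pos_left two_pos
    ((div_pos two_pos hβ).trans (two_div_lt_add_sqrt hβ hαβ x)) (strictMono_add_sqrt hβ hαβ hxy)

/-- Lemma 6 of the paper.
For any `α > 0` and `β > 0` with `αβ > 1`, the function
`x ↦ β/2 + α/(2x) − √((α + βx)² − 4x)/(2x)` is continuous and strictly decreasing
on `(0, ∞)`, and continuous and strictly decreasing on `(−∞, 0)`. -/
theorem gamma_minus_decreasing_of_alpha_beta_gt_one (α β : ℝ)
    (hα : 0 < α) (hβ : 0 < β) (hαβ : 1 < α * β) :
    ContinuousOn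
        (fun x : ℝ => β / 2 + α / (2 * x) - Real.sqrt ((α + β * x) ^ 2 - 4 * x) / (2 * x))
        (Set.Ioi 0) ∧
      StrictAntiOn
        (fun x : ℝ => β / 2 + α / (2 * x) - Real.sqrt ((α + β * x) ^ 2 - 4 * x) / (2 * x))
        (Set.Ioi 0) ∧
      ContinuousOn
        (fun x : ℝ => β / 2 + α / (2 * x) - Real.sqrt ((α + β * x) ^ 2 - 4 * x) / (2 * x))
        (Set.Iio 0) ∧
      StrictAntiOn
        (fun x : ℝ => β / 2 + α / (2 * x) - Real.sqrt ((α + β * x) ^ 2 - 4 * x) / (2 * x))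
        (Set.Iio 0) := by
  have hpos : ∀ x ∈ Set.Ioi (0 : ℝ), x ≠ 0 := fun _ hx => ne_of_gt hx
  have hneg : ∀ x ∈ Set.Iio (0 : ℝ), x ≠ 0 := fun _ hx => ne_of_lt hx
  exact ⟨continuousOn_gamma_minus α β hpos, strictAntiOn_gamma_minus hβ hαβ hpos,
    continuousOn_gamma_minus α β hneg, strictAntiOn_gamma_minus hβ hαβ hneg⟩
end
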